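/- For all n ≥ 5, the number f_n^2(σ) of permutations π ∈ S_n with θ²(π) = π that avoid σ equals: 4 if σ = 213; 3 if σ = 132; and 0 if σ = 123. -/

import Mathlib

/-- The one-line word of the image of `π` under the fundamental bijection:
write `π` in standard cycle form (every cycle written with its largest element
first, cycles listed in increasing order of their largest elements) and erase
the parentheses.  The cycle maxima are exactly the `x` with `π^[k] x ≤ x` for
all `k`, and the cycle of `x` is `x, π x, π² x, …` up to the period of `x`. -/
noncomputable def fundWord {n : ℕ} (π : Equiv.Perm (Fin n)) : List (Fin n) :=
  ((List.finRange n).filter fun x => (List.range n).all fun k => decide ((⇑π)^[k] x ≤ x)).flatMap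
    fun x => (List.range (Function.minimalPeriod (⇑π) x)).map fun k => (⇑π)^[k] x

/-- The permutation whose one-line notation is the word `w`
(junk value if `w` is not the one-line notation of a permutation). -/
noncomputable def permOfWord {n : ℕ} (w : List (Fin n)) : Equiv.Perm (Fin n) :=
  Function.invFun (fun σ : Equiv.Perm (Fin n) => (List.finRange n).map ⇑σ) w

/-- The fundamental bijection `θ`. -/
noncomputable def theta {n : ℕ} (π : Equiv.Perm (Fin n)) : Equiv.Perm (Fin n) :=
  permOfWord (fundWord π)

/-- `π` contains the pattern `σ`. -/
def Contains {k n : ℕ} (σ : Equiv.Perm (Fin k)) (π : Equiv.Perm (Fin n)) : Prop :=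
  ∃ f : Fin k → Fin n, StrictMono f ∧ ∀ a b : Fin k, π (f a) < π (f b) ↔ σ a < σ b

/-- `π` avoids the pattern `σ`. -/
def Avoids {k n : ℕ} (π : Equiv.Perm (Fin n)) (σ : Equiv.Perm (Fin k)) : Prop :=
  ¬ Contains σ π

noncomputable def p123 : Equiv.Perm (Fin 3) := Equiv.ofBijective ![0, 1, 2] (by decide)
noncomputable def p132 : Equiv.Perm (Fin 3) := Equiv.ofBijective ![0, 2, 1] (by decide)
noncomputable def p213 : Equiv.Perm (Fin 3) := Equiv.ofBijective ![1, 0, 2] (by decide)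
noncomputable def p231 : Equiv.Perm (Fin 3) := Equiv.ofBijective ![1, 2, 0] (by decide)
noncomputable def p312 : Equiv.Perm (Fin 3) := Equiv.ofBijective ![2, 0, 1] (by decide)
noncomputable def p321 : Equiv.Perm (Fin 3) := Equiv.ofBijective ![2, 1, 0] (by decide)

/-- The direct sum `π ⊕ τ` of two permutations. -/
def directSum {n m : ℕ} (π : Equiv.Perm (Fin n)) (τ : Equiv.Perm (Fin m)) :
    Equiv.Perm (Fin (n + m)) :=
  finSumFinEquiv.permCongr (Equiv.sumCongr π τ)

/-- A permutation is irreducible if it is not a direct sum of two nonempty permutations. -/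
def IrreduciblePerm {n : ℕ} (π : Equiv.Perm (Fin n)) : Prop :=
  ¬ ∃ (a b : ℕ) (_ : 0 < a) (_ : 0 < b) (h : a + b = n)
      (σ : Equiv.Perm (Fin a)) (τ : Equiv.Perm (Fin b)),
      π = (finCongr h).permCongr (directSum σ τ)

/-- A permutation is cyclic if its cycle decomposition is a single cycle of full length,
i.e. it acts transitively. -/
def IsCyclicPerm {n : ℕ} (π : Equiv.Perm (Fin n)) : Prop :=
  ∀ x y : Fin n, ∃ k : ℕ, (⇑π)^[k] x = y

open Function in
theorem minimalPeriod_perm_pos {n : ℕ} (π : Equiv.Perm (Fin n)) (x : Fin n) :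
    0 < minimalPeriod π x :=
  minimalPeriod_pos_of_mem_periodicPts (π.injective.mem_periodicPts x)

/-- The cycle `x, π x, π² x, …` as a list. -/
noncomputable def cycleWord {n : ℕ} (π : Equiv.Perm (Fin n)) (x : Fin n) : List (Fin n) :=
  (List.range (Function.minimalPeriod (⇑π) x)).map fun k => (⇑π)^[k] x

/-- The cycle maxima of `π` in increasing order. -/
def cycleMaxima {n : ℕ} (π : Equiv.Perm (Fin n)) : List (Fin n) :=
  (List.finRange n).filter fun x => (List.range n).all fun k => decide ((⇑π)^[k] x ≤ x)

theorem fundWord_eq {n : ℕ} (π : Equiv.Perm (Fin n)) :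
    fundWord π = (cycleMaxima π).flatMap (cycleWord π) := rfl

theorem nodup_cycleWord {n : ℕ} (π : Equiv.Perm (Fin n)) (x : Fin n) :
    (cycleWord π x).Nodup := by
  refine List.Nodup.map_on ?_ List.nodup_range
  intro a ha b hb h
  exact (Function.iterate_eq_iterate_iff_of_lt_minimalPeriod (by simpa using ha)
    (by simpa using hb)).1 h

theorem minimalPeriod_perm_le {n : ℕ} (π : Equiv.Perm (Fin n)) (x : Fin n) :
    Function.minimalPeriod π x ≤ n := by
  simpa [cycleWord] using (nodup_cycleWord π x).length_le_card

theorem mem_cycleWord {n : ℕ} {π : Equiv.Perm (Fin n)} {x y : Fin n} :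
    y ∈ cycleWord π x ↔ ∃ k, (⇑π)^[k] x = y := by
  constructor
  · intro h
    obtain ⟨k, -, hk⟩ := List.mem_map.1 h
    exact ⟨k, hk⟩
  · rintro ⟨k, rfl⟩
    refine List.mem_map.2 ⟨k % Function.minimalPeriod π x, ?_,
      Function.iterate_mod_minimalPeriod_eq⟩
    simpa using Nat.mod_lt _ (minimalPeriod_perm_pos π x)

theorem mem_cycleMaxima {n : ℕ} {π : Equiv.Perm (Fin n)} {x : Fin n} :
    x ∈ cycleMaxima π ↔ ∀ k, (⇑π)^[k] x ≤ x := by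
  simp only [cycleMaxima, List.mem_filter, List.mem_finRange, true_and, List.all_eq_true,
    List.mem_range, decide_eq_true_eq]
  refine ⟨fun h k => ?_, fun h k _ => h k⟩
  rw [← Function.iterate_mod_minimalPeriod_eq]
  exact h _ ((Nat.mod_lt _ (minimalPeriod_perm_pos π x)).trans_le (minimalPeriod_perm_le π x))

theorem pairwise_cycleMaxima {n : ℕ} (π : Equiv.Perm (Fin n)) :
    (cycleMaxima π).Pairwise (· < ·) :=
  (List.pairwise_lt_finRange n).filter _

theorem exists_iterate_eq_symm {n : ℕ} (π : Equiv.Perm (Fin n)) {x y : Fin n} {k : ℕ}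
    (h : (⇑π)^[k] x = y) : ∃ l, (⇑π)^[l] y = x := by
  have hp : Function.IsPeriodicPt π (Function.minimalPeriod π x * k) x :=
    (Function.isPeriodicPt_minimalPeriod π x).mul_const k
  have hk : k ≤ Function.minimalPeriod π x * k :=
    Nat.le_mul_of_pos_left k (minimalPeriod_perm_pos π x)
  refine ⟨Function.minimalPeriod π x * k - k, ?_⟩
  rw [← h, ← Function.iterate_add_apply, Nat.sub_add_cancel hk]
  exact hp

theorem exists_mem_cycleMaxima {n : ℕ} (π : Equiv.Perm (Fin n)) (x : Fin n) :
    ∃ m ∈ cycleMaxima π, x ∈ cycleWord π m := by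
  obtain ⟨m, hm, hmax⟩ := (cycleWord π x).toFinset.exists_maximal
    ⟨x, by simpa using mem_cycleWord.2 ⟨0, rfl⟩⟩
  rw [List.mem_toFinset, mem_cycleWord] at hm
  obtain ⟨k, hk⟩ := hm
  refine ⟨m, mem_cycleMaxima.2 fun l => ?_, mem_cycleWord.2 (exists_iterate_eq_symm π hk)⟩
  refine le_of_not_gt fun hlt => hlt.not_ge (hmax ?_ hlt.le)
  refine List.mem_toFinset.2 (mem_cycleWord.2 ?_)
  exact ⟨l + k, by rw [Function.iterate_add_apply, hk]⟩

theorem nodup_fundWord {n : ℕ} (π : Equiv.Perm (Fin n)) : (fundWord π).Nodup := by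
  rw [fundWord_eq, List.nodup_flatMap]
  refine ⟨fun x _ => nodup_cycleWord π x, ?_⟩
  refine List.Pairwise.imp_of_mem ?_ (pairwise_cycleMaxima π)
  intro a b ha hb hab y hya hyb
  rw [mem_cycleMaxima] at ha hb
  obtain ⟨k, hk⟩ := mem_cycleWord.1 hya
  obtain ⟨l, hl⟩ := mem_cycleWord.1 hyb
  obtain ⟨l', hl'⟩ := exists_iterate_eq_symm π hl
  refine absurd (ha (l' + k)) (not_le.2 ?_)
  rwa [Function.iterate_add_apply, hk, hl']

theorem mem_fundWord {n : ℕ} (π : Equiv.Perm (Fin n)) (x : Fin n) : x ∈ fundWord π := by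
  rw [fundWord_eq, List.mem_flatMap]
  exact exists_mem_cycleMaxima π x

theorem length_fundWord {n : ℕ} (π : Equiv.Perm (Fin n)) : (fundWord π).length = n := by
  have h := List.toFinset_card_of_nodup (nodup_fundWord π)
  rw [← h, Finset.eq_univ_of_forall (fun x => List.mem_toFinset.2 (mem_fundWord π x)),
    Finset.card_univ, Fintype.card_fin]

theorem map_theta {n : ℕ} (π : Equiv.Perm (Fin n)) :
    (List.finRange n).map (theta π) = fundWord π := by
  have hlen := length_fundWord π
  have hinj : Function.Injective fun i : Fin n => (fundWord π)[i.1]'(by omega) := by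
    intro i j h
    exact Fin.ext ((nodup_fundWord π).getElem_inj_iff.1 h)
  refine Function.invFun_eq (f := fun σ : Equiv.Perm (Fin n) => (List.finRange n).map ⇑σ)
    ⟨Equiv.ofBijective _ (Finite.injective_iff_bijective.1 hinj), ?_⟩
  refine List.ext_getElem (by simp [hlen]) fun i h₁ h₂ => ?_
  simp

theorem theta_apply {n : ℕ} (π : Equiv.Perm (Fin n)) (i : Fin n) :
    theta π i = (fundWord π)[i.1]'(by rw [length_fundWord]; exact i.2) := by
  have h := map_theta π
  simp [← h]

theorem fundWord_split {n : ℕ} (π : Equiv.Perm (Fin n)) (x : Fin n) :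
    ∃ (A B : List (Fin n)) (m : Fin n) (k : ℕ), fundWord π = A ++ cycleWord π m ++ B ∧
      k < Function.minimalPeriod π m ∧ (⇑π)^[k] m = x ∧ (∀ l, (⇑π)^[l] m ≤ m) ∧
      (∀ a ∈ A, a < m) ∧ ∀ b, B[0]? = some b → m < b := by
  obtain ⟨m, hm, hx⟩ := exists_mem_cycleMaxima π x
  obtain ⟨k, hk, hkx⟩ := List.mem_map.1 hx
  obtain ⟨L₁, L₂, hL⟩ := List.append_of_mem hm
  have hsort := pairwise_cycleMaxima π
  rw [hL, List.pairwise_append, List.pairwise_cons] at hsort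
  refine ⟨L₁.flatMap (cycleWord π), L₂.flatMap (cycleWord π), m, k, ?_, by simpa using hk, hkx,
    mem_cycleMaxima.1 hm, fun a ha => ?_, fun b hb => ?_⟩
  · rw [fundWord_eq, hL]
    simp
  · obtain ⟨y, hy, hay⟩ := List.mem_flatMap.1 ha
    obtain ⟨l, rfl⟩ := mem_cycleWord.1 hay
    have hy' : y ∈ cycleMaxima π := by rw [hL]; simp [hy]
    exact (mem_cycleMaxima.1 hy' l).trans_lt (hsort.2.2 y hy m (by simp))
  · cases L₂ with
    | nil => simp at hb
    | cons y L =>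
      have hpos := minimalPeriod_perm_pos π y
      have hby : y = b := by
        simpa [cycleWord, List.getElem?_append, hpos] using hb
      exact hby ▸ hsort.2.1.1 y (by simp)

/-- `Step n P T` says that `T` acts on the word `P 1, …, P n` by cyclically rotating each
block starting at a left-to-right maximum. -/
def Step (n : ℕ) (P T : ℕ → ℕ) : Prop :=
  ∀ i, 1 ≤ i → i ≤ n → ∃ m, 1 ≤ m ∧ m ≤ i ∧ (∀ k, 1 ≤ k → k ≤ i → P k ≤ P m) ∧
    ((i < n ∧ P (i + 1) < P m ∧ T (P i) = P (i + 1)) ∨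
      ((i < n → P m < P (i + 1)) ∧ T (P i) = P m))

/-- A permutation of `Fin n` as a map on `{1, …, n}`. -/
def natMap {n : ℕ} (π : Equiv.Perm (Fin n)) (i : ℕ) : ℕ :=
  if h : i - 1 < n then (π ⟨i - 1, h⟩ : ℕ) + 1 else 0

theorem natMap_succ {n : ℕ} (π : Equiv.Perm (Fin n)) {i : ℕ} (h : i < n) :
    natMap π (i + 1) = (π ⟨i, h⟩ : ℕ) + 1 := by
  simp [natMap, h]

theorem step_theta {n : ℕ} (π : Equiv.Perm (Fin n)) :
    Step n (natMap (theta π)) (natMap π) := by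
  intro i hi hin
  obtain ⟨i, rfl⟩ := Nat.exists_eq_add_of_le' hi
  have hlen := length_fundWord π
  have hT : ∀ j (hj : j < n), natMap (theta π) (j + 1) =
      ((fundWord π)[j]'(by omega) : ℕ) + 1 := by
    intro j hj
    rw [natMap_succ _ hj, theta_apply]
  have hπ : ∀ x : Fin n, natMap π (x + 1) = (π x : ℕ) + 1 := fun x => natMap_succ π x.2
  obtain ⟨A, B, m, k, hw, hk, hx, hm, hA, hB⟩ :=
    fundWord_split π ((fundWord π)[i]'(by omega))
  have hlen' : A.length + Function.minimalPeriod π m + B.length = n := by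
    have h := congrArg List.length hw
    rw [hlen] at h
    simpa [cycleWord, Nat.add_assoc] using h.symm
  have hmid : ∀ l (hl : l < Function.minimalPeriod π m),
      (fundWord π)[A.length + l]'(by omega) = (⇑π)^[l] m := by
    intro l hl
    simp [hw, cycleWord, hl]
  have hi' : i = A.length + k := by
    rw [← hmid k hk] at hx
    exact ((nodup_fundWord π).getElem_inj_iff.1 hx).symm
  subst hi'
  have hm0 := hmid 0 (by omega)
  refine ⟨A.length + 1, by omega, by omega, ?_, ?_⟩
  · intro j hj hji
    obtain ⟨j, rfl⟩ := Nat.exists_eq_add_of_le' hj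
    rw [hT _ (by omega), hT _ (by omega)]
    suffices h : (fundWord π)[j]'(by omega) ≤ (fundWord π)[A.length]'(by omega) by
      exact Nat.succ_le_succ h
    simp only [Nat.add_zero, Function.iterate_zero, id] at hm0
    rw [hm0]
    by_cases hjA : j < A.length
    · have : (fundWord π)[j]'(by omega) = A[j] := by
        simp [hw, hjA]
      rw [this]
      exact (hA _ (List.getElem_mem _)).le
    · obtain ⟨l, rfl⟩ := Nat.exists_eq_add_of_le (not_lt.1 hjA)
      rw [hmid l (by omega)]
      exact hm l
  · simp only [Nat.add_zero, Function.iterate_zero, id] at hm0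
    rw [hT (A.length + k) (by omega), hT A.length (by omega), hm0, hπ, hmid k hk,
      ← Function.iterate_succ_apply' (⇑π) k m]
    by_cases hk1 : k + 1 < Function.minimalPeriod π m
    · left
      rw [hT _ (by omega)]
      have := hmid (k + 1) hk1
      simp only [← Nat.add_assoc] at this
      rw [this]
      refine ⟨by omega, ?_, rfl⟩
      refine Nat.succ_lt_succ (lt_of_le_of_ne (hm (k + 1)) fun h => ?_)
      exact Function.not_isPeriodicPt_of_pos_of_lt_minimalPeriod (by omega) hk1 (Fin.ext h)
    · right
      have hper : k + 1 = Function.minimalPeriod π m := by omega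
      refine ⟨fun hlt => ?_, ?_⟩
      · rw [hT _ hlt]
        refine Nat.succ_lt_succ (hB _ ?_)
        have : (fundWord π)[A.length + k + 1]? = B[0]? := by
          rw [hw, List.getElem?_append_right (by simp [cycleWord]; omega)]
          congr 1
          simp [cycleWord]
          omega
        rw [← this, List.getElem?_eq_getElem]
      · rw [Nat.succ_eq_add_one, hper, Function.iterate_minimalPeriod]

theorem Step.eq {n : ℕ} {P T T' : ℕ → ℕ} (h : Step n P T) (h' : Step n P T') {i : ℕ}
    (hi : 1 ≤ i) (hin : i ≤ n) : T (P i) = T' (P i) := by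
  obtain ⟨m, hm, hmi, hmax, hT⟩ := h i hi hin
  obtain ⟨m', hm', hmi', hmax', hT'⟩ := h' i hi hin
  have := hmax m' hm' hmi'
  have := hmax' m hm hmi
  omega

theorem Step.perm_eq {n : ℕ} {τ π π' : Equiv.Perm (Fin n)} (h : Step n (natMap τ) (natMap π))
    (h' : Step n (natMap τ) (natMap π')) : π = π' := by
  ext x
  have hx := h.eq h' (i := (τ.symm x : ℕ) + 1) (by omega) (by omega)
  rw [natMap_succ τ (τ.symm x).2] at hx
  simpa [natMap_succ _ x.2] using hx

theorem theta_eq_iff {n : ℕ} {π τ : Equiv.Perm (Fin n)} :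
    theta π = τ ↔ Step n (natMap τ) (natMap π) := by
  refine ⟨fun h => h ▸ step_theta π, fun h => ?_⟩
  have hinj : Function.Injective (theta (n := n)) := fun σ σ' hσ =>
    (step_theta σ).perm_eq (hσ ▸ step_theta σ')
  obtain ⟨σ, rfl⟩ := Finite.injective_iff_surjective.1 hinj τ
  rw [h.perm_eq (step_theta σ)]

/-- `P` permutes `{1, …, n}`. -/
structure PermOn (n : ℕ) (P : ℕ → ℕ) : Prop where
  mem : ∀ i, 1 ≤ i → i ≤ n → 1 ≤ P i ∧ P i ≤ n
  inj : ∀ i j, 1 ≤ i → i ≤ n → 1 ≤ j → j ≤ n → P i = P j → i = j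
  surj : ∀ v, 1 ≤ v → v ≤ n → ∃ k, 1 ≤ k ∧ k ≤ n ∧ P k = v

/-- `P` and `T` are permutations of `{1, …, n}` exchanged by the fundamental bijection. -/
structure Swapped (n : ℕ) (P T : ℕ → ℕ) : Prop where
  left : PermOn n P
  right : PermOn n T
  step : Step n P T
  step' : Step n T P

theorem Swapped.symm {n : ℕ} {P T : ℕ → ℕ} (h : Swapped n P T) : Swapped n T P :=
  ⟨h.right, h.left, h.step', h.step⟩

theorem Swapped.after {n : ℕ} {P T : ℕ → ℕ} (h : Swapped n P T) {p : ℕ} (hp : 1 ≤ p)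
    (hpn : P p = n) (i : ℕ) (hpi : p ≤ i) (hi : i < n) : T (P i) = P (i + 1) := by
  obtain ⟨m, hm, hmi, hmax, h₁ | h₁⟩ := h.step i (by omega) (by omega)
  · exact h₁.2.2
  · have := hmax p hp hpi
    have := h.left.mem (i + 1) (by omega) (by omega)
    omega

theorem Swapped.last {n : ℕ} {P T : ℕ → ℕ} (h : Swapped n P T) (hn : 1 ≤ n) : T (P n) = n := by
  obtain ⟨p, hp, hpn, hP⟩ := h.left.surj n hn le_rfl
  obtain ⟨m, hm, hmi, hmax, h₁ | h₁⟩ := h.step n (by omega) (by omega)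
  · omega
  · have := hmax p hp hpn
    have := h.left.mem m hm hmi
    omega

theorem Swapped.apply_last_lt {n : ℕ} {P T : ℕ → ℕ} (h : Swapped n P T) {p : ℕ} (hp : 1 ≤ p)
    (hpn : P p = n) (hlt : p < n) : P n < n := by
  have := h.left.mem n (by omega) le_rfl
  have := h.left.inj p n hp hlt.le (by omega) le_rfl
  omega

theorem Swapped.apply_last_succ {n : ℕ} {P T : ℕ → ℕ} (h : Swapped n P T) {p : ℕ} (hp : 1 ≤ p)
    (hpn : P p = n) (hlt : p < n) : T (P n + 1) = P n := by
  have h₁ := h.left.mem n (by omega) le_rfl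
  have h₂ := h.symm.after h₁.1 (h.last (by omega)) (P n) le_rfl (h.apply_last_lt hp hpn hlt)
  rw [← h₂, h.last (by omega)]

/-- If the word starts with its largest letter, then the second letter is `1`. -/
theorem Swapped.apply_two {n : ℕ} {P T : ℕ → ℕ} (h : Swapped n P T) (hn : 2 ≤ n)
    (h1 : P 1 = n) : P 2 = 1 := by
  have hT : T n = P 2 := by
    have := h.after le_rfl h1 1 le_rfl hn
    rwa [h1] at this
  obtain ⟨i, hi, hin, hTi⟩ := h.right.surj 1 le_rfl (by omega)
  obtain ⟨m, hm, hmi, hmax, h₁⟩ := h.step' i hi hin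
  rw [hTi, h1] at h₁
  have := h.right.mem m hm (by omega)
  have := h.right.mem (i + 1) (by omega)
  have : i = n := by omega
  rw [← hT, ← this, hTi]

theorem Swapped.fix_last {n : ℕ} {P T : ℕ → ℕ} (h : Swapped n P T) (hn : 3 ≤ n)
    (av : ∀ a b c, 1 ≤ a → a < b → b < c → c ≤ n → ¬ (P a < P c ∧ P c < P b)) :
    P n = n ∨ n = 4 ∧ P 1 = 3 ∧ P 2 = 4 ∧ P 3 = 2 ∧ P 4 = 1 := by
  obtain ⟨p, hp, hpn, hPp⟩ := h.left.surj n (by omega) le_rfl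
  rcases hpn.eq_or_lt with rfl | hpn
  · exact Or.inl hPp
  right
  have inj := h.left.inj
  have mem := h.left.mem
  have surj := h.left.surj
  have hafter := h.after hp hPp
  have hTn := h.last (by omega)
  have hjn := h.apply_last_lt hp hPp hpn
  have hj := h.apply_last_succ hp hPp hpn
  have hj1 := (mem n (by omega) le_rfl).1
  have hafter' := h.symm.after hj1 hTn
  have hA : ∀ k l, 1 ≤ k → k < p → p < l → l ≤ n → P l < P k := by
    intro k l hk hkp hpl hl
    have := av k p l hk hkp hpl hl
    have := inj k l hk (by omega) (by omega) hl
    have := inj p l hp (by omega) (by omega) hl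
    have := mem l (by omega) hl
    omega
  rcases hp.eq_or_lt with rfl | hp2
  · have h2 := h.apply_two (by omega) hPp
    obtain ⟨k, hk, hkn, hPk⟩ := surj (P n + 1) (by omega) (by omega)
    have hkn' : k ≠ n := by rintro rfl; omega
    have hk' := hafter k hk (by omega)
    rw [hPk, hj] at hk'
    have := inj _ _ (by omega) le_rfl (by omega) (by omega) hk'
    have := av 2 k n (by omega)
    have : k ≠ 2 := by rintro rfl; omega
    have : k ≠ 1 := by rintro rfl; omega
    have := inj 2 n
    omega
  · have hTA : ∀ k, 1 ≤ k → k < p → ∃ k', 1 ≤ k' ∧ k' < p ∧ T (P k) = P k' := by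
      intro k hk hkp
      obtain ⟨m, hm, hmi, hmax, h₁ | h₁⟩ := h.step k hk (by omega)
      · refine ⟨k + 1, by omega, ?_, h₁.2.2⟩
        have : k + 1 ≠ p := by
          intro h2
          have := mem m hm (by omega)
          rw [h2] at h₁
          omega
        omega
      · exact ⟨m, hm, by omega, h₁.2⟩
    have key : ∀ k, 1 ≤ k → k < p → P k ≠ p + 1 → P k < p := by
      intro k hk hkp hne
      obtain ⟨i, hi, hin, hTi⟩ := h.right.surj (P k) (mem k hk (by omega)).1 (mem k hk (by omega)).2
      obtain ⟨k', hk', hkn', rfl⟩ := surj i hi hin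
      have hk'p : k' < p := by
        by_contra hcon
        rcases hkn'.eq_or_lt with rfl | hlt
        · have := inj k p; grind
        · have := hafter k' (by omega) hlt
          have := inj k (k' + 1)
          grind
      have hjk := hA k' n hk' hk'p hpn le_rfl
      have hlt : P k' < n := by
        have := inj k' p
        omega
      have hPv := hafter' (P k') hjk.le hlt
      rw [hTi] at hPv
      obtain ⟨k2, hk2, hkn2, hP2⟩ := surj (P k' + 1) (by omega) (by omega)
      rw [← hP2] at hPv
      have memk := mem k hk (by omega)
      rcases lt_trichotomy k2 p with h2 | rfl | h2
      · obtain ⟨k3, hk3, hk3p, h3⟩ := hTA k2 hk2 h2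
        rw [h3] at hPv
        have := inj _ _ memk.1 memk.2 hk3 (by omega) hPv
        omega
      · rw [hafter k2 le_rfl hpn] at hPv
        have := inj _ _ memk.1 memk.2 (by omega) (by omega) hPv
        omega
      · have := hA k' k2 hk' hk'p h2 hkn2
        omega
    obtain ⟨k0, hk0, hkn0, hP0⟩ := surj (n - 1) (by omega) (by omega)
    have hk0p : k0 < p := by
      have h1 : k0 ≠ p := by rintro rfl; omega
      by_contra hcon
      have := hA 1 k0 le_rfl hp2 (by omega) hkn0
      have := mem 1 le_rfl (by omega)
      have := inj 1 p
      omega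
    obtain ⟨d, hd, hdp, hTd⟩ := hTA k0 hk0 hk0p
    have h1 := hafter' (n - 1) (by omega) (by omega)
    rw [← hP0, hTd, hP0, show n - 1 + 1 = n by omega] at h1
    have h2 := hafter p le_rfl hpn
    rw [hPp, ← h1] at h2
    have hd' := inj _ _ (mem d hd (by omega)).1 (mem d hd (by omega)).2 (by omega) (by omega) h2
    have hP0' : P k0 = p + 1 := by
      by_contra hne
      have := key k0 hk0 hk0p hne
      have := inj d p
      have := mem d hd (by omega)
      omega
    have hn4 : n = 4 := by
      by_contra hn4
      obtain ⟨k1, hk1, hkn1, hP1⟩ := surj (n - 2) (by omega) (by omega)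
      have hk1p : k1 < p := by
        have h1 : k1 ≠ p := by rintro rfl; omega
        by_contra hcon
        have := hA 1 k1 le_rfl hp2 (by omega) hkn1
        have := hA 2 k1 (by omega) (by omega) (by omega) hkn1
        have := mem 1 le_rfl (by omega)
        have := mem 2 (by omega) (by omega)
        have := inj 1 p
        have := inj 2 p
        have := inj 1 2
        omega
      have := key k1 hk1 hk1p (by omega)
      omega
    subst hn4
    obtain rfl : p = 2 := by omega
    have := hA 1 3
    have := hA 1 4
    have := mem 1
    have := mem 3
    have := mem 4
    have := inj 1 2
    have := inj 3 4
    have hP3 : P 3 ≠ 1 := by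
      intro hP3
      have hP4 : P 4 = 2 := by omega
      rw [hP4] at hj
      obtain ⟨k', _, _, hk'⟩ := hTA 1 le_rfl (by omega)
      obtain rfl : k' = 1 := by omega
      have hP1 : P 1 = 3 := by omega
      rw [hP1] at hk'
      simp only [Nat.reduceAdd] at hj
      omega
    omega

set_option maxHeartbeats 1000000 in
/-- The only word of length at least `3` starting with its largest letter and avoiding `213`
that is fixed by the square of the fundamental bijection is `4132`. -/
theorem Swapped.eq_of_max_first {n : ℕ} {P T : ℕ → ℕ} (h : Swapped n P T) (hn : 3 ≤ n)
    (hPp : P 1 = n)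
    (av : ∀ a b c, 1 ≤ a → a < b → b < c → c ≤ n → ¬ (P b < P a ∧ P a < P c)) :
    n = 4 ∧ P 1 = 4 ∧ P 2 = 1 ∧ P 3 = 3 ∧ P 4 = 2 := by
  have hPq := h.apply_two (by omega) hPp
  have inj := h.left.inj
  have mem := h.left.mem
  have surj := h.left.surj
  have hafter := h.after le_rfl hPp
  have hTn := h.last (by omega)
  have hjn := h.apply_last_lt le_rfl hPp (by omega)
  have hj := h.apply_last_succ le_rfl hPp (by omega)
  have hj1 := (mem n (by omega) le_rfl).1
  have hafter' := h.symm.after hj1 hTn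
  have hT1 := hafter 2 (by omega) (by omega)
  rw [hPq] at hT1
  simp only [Nat.reduceAdd] at hT1
  have hjne : P n ≠ 1 := by
    have := inj 2 n
    omega
  obtain ⟨m, hm, hm1, -, hm2⟩ := h.step' 1 le_rfl (by omega)
  obtain rfl : m = 1 := by omega
  rw [hT1] at hm2
  simp only [Nat.reduceAdd] at hm2
  by_cases hj2 : P n = 2
  · rw [hj2] at hj hTn
    simp only [Nat.reduceAdd] at hj
    have := mem 3
    have h3 : P 3 = 3 := by
      have := inj (P 3) 3
      have := inj 3 1
      grind
    have hn3 : n ≠ 3 := by rintro rfl; omega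
    have h4 := hafter 3 (by omega) (by omega)
    have := inj 4 n
    grind
  exfalso
  have hn4 : n ≠ 3 := by
    rintro rfl
    have := mem 3
    have := inj 3 1
    omega
  obtain ⟨t, ht, htn, hPt⟩ := surj 2 (by omega) (by omega)
  have ht1 : t ≠ 1 := by rintro rfl; omega
  have ht2 : t ≠ 2 := by rintro rfl; omega
  have htn' : t ≠ n := by rintro rfl; omega
  have hne3 : P 3 ≠ 3 := by
    intro h3
    have : t ≠ 3 := by rintro rfl; omega
    have := av 3 t n
    have := inj 3 n
    omega
  have hyt : P (P 3) = P (t + 1) := by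
    have h2 := hafter t (by omega) (by omega)
    rw [hPt] at h2
    have := mem 3
    have := inj (P 3) 3
    omega
  have hy : P 3 = t + 1 := by
    have := mem 3
    exact inj _ _ (by omega) (by omega) (by omega) (by omega) hyt
  have ht3 : t ≠ 3 := by rintro rfl; omega
  have htop : n - 1 ≤ t + 1 := by
    obtain ⟨k, hk, hkn, hPk⟩ := surj (n - 1) (by omega) (by omega)
    by_cases hk3 : k = 3
    · subst hk3; omega
    have hkt : k < t := by
      have h1 : k ≠ t := by rintro rfl; omega
      by_contra hcon
      have := av 3 t k
      have := mem 3
      have := inj 3 1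
      have := inj 3 k
      omega
    have hk1 : k ≠ 1 := by rintro rfl; omega
    have hk2 : k ≠ 2 := by rintro rfl; omega
    have hTi := hafter (k - 1) (by omega) (by omega)
    rw [show k - 1 + 1 = k by omega, hPk] at hTi
    have := mem (k - 1)
    have := inj (k - 1) 1
    have := inj (k - 1) 2
    have := inj (k - 1) t
    have := inj (k - 1) n
    have := av (k - 1) t n
    have h1 := hafter' (P (k - 1)) (by omega) (by omega)
    rw [hTi] at h1
    obtain ⟨k2, hk2', hkn2, hP2⟩ := surj (P (k - 1) + 1) (by omega) (by omega)
    have hk2t : k2 < t := by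
      have h2 : k2 ≠ t := by rintro rfl; omega
      by_contra hcon
      have := av (k - 1) t k2
      omega
    rw [← hP2, hafter k2 (by omega) (by omega)] at h1
    have := inj (n - 1) (k2 + 1)
    omega
  have hn1 : P (n - 1) = P n + 1 := by
    obtain ⟨k, hk, hkn, hPk⟩ := surj (P n + 1) (by omega) (by omega)
    have hkn' : k ≠ n := by rintro rfl; omega
    have h1 := hafter k hk (by omega)
    rw [hPk, hj] at h1
    have := inj n (k + 1)
    rw [show n - 1 = k by omega, hPk]
  have htn1 : t ≠ n - 1 := by rintro rfl; omega
  have hj3 : P n = 3 := by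
    by_contra hne
    obtain ⟨k, hk, hkn, hPk⟩ := surj 3 (by omega) (by omega)
    have h1 : k ≠ 1 := by rintro rfl; omega
    have h2 : k ≠ 2 := by rintro rfl; omega
    have h3 : k ≠ n := by rintro rfl; omega
    have h4 : k ≠ n - 1 := by rintro rfl; omega
    have h5 : k ≠ t := by rintro rfl; omega
    have := av k t n
    omega
  have hT2 := hafter t (by omega) (by omega)
  rw [hPt, show t + 1 = n - 1 by omega, hn1, hj3] at hT2
  rw [hj3] at hTn
  obtain ⟨m, hm, hm2, hmax, h₁⟩ := h.step' 2 (by omega) (by omega)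
  have := hmax 1 le_rfl (by omega)
  have := h.right.mem m
  have := h.right.inj m 3
  have := inj 3 4
  simp only [Nat.reduceAdd] at hT2 h₁
  rw [hT2] at h₁
  omega

theorem Swapped.fix_first {n : ℕ} {P T : ℕ → ℕ} (h : Swapped n P T) (hn : 3 ≤ n)
    (av : ∀ a b c, 1 ≤ a → a < b → b < c → c ≤ n → ¬ (P b < P a ∧ P a < P c)) :
    P 1 = 1 ∨ n = 4 ∧ (P 1 = 3 ∧ P 2 = 4 ∧ P 3 = 2 ∧ P 4 = 1 ∨
      P 1 = 4 ∧ P 2 = 1 ∧ P 3 = 3 ∧ P 4 = 2) := by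
  obtain ⟨q, hq, hqn, hPq⟩ := h.left.surj 1 le_rfl (by omega)
  rcases hq.eq_or_lt with rfl | hq1
  · exact Or.inl hPq
  right
  have inj := h.left.inj
  have mem := h.left.mem
  have surj := h.left.surj
  obtain ⟨p, hp, hpn', hPp⟩ := surj n (by omega) le_rfl
  have hpq : p < q := by
    by_contra hcon
    have := av 1 q p le_rfl hq1
    have := inj 1 q
    have := inj 1 p
    have := mem 1
    have : p ≠ q := by rintro rfl; omega
    omega
  have hpn : p < n := by omega
  have hafter := h.after hp hPp
  have hTn := h.last (by omega)
  have hjn := h.apply_last_lt hp hPp hpn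
  have hj := h.apply_last_succ hp hPp hpn
  have hj1 := (mem n (by omega) le_rfl).1
  have hafter' := h.symm.after hj1 hTn
  have hinc : ∀ k l, 1 ≤ k → k < l → l ≤ p → P k < P l := by
    intro k l hk hkl hlp
    have := mem k
    have := inj k p
    have := inj k l
    rcases hlp.eq_or_lt with rfl | hlp
    · omega
    · have := av k l p
      omega
  have hbefore : ∀ k, 1 ≤ k → k < p → T (P k) = P k := by
    intro k hk hkp
    obtain ⟨m, hm, hmi, hmax, h₁⟩ := h.step k hk (by omega)
    have := hmax k hk le_rfl
    have hmk : m = k := by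
      by_contra hne
      have := hinc m k hm (by omega) (by omega)
      omega
    subst hmk
    have := hinc m (m + 1) hm (by omega) (by omega)
    omega
  have hA : ∀ k l, 1 ≤ k → k < q → q < l → l ≤ n → P l < P k := by
    intro k l hk hkq hql hl
    have := av k q l
    have := inj k l
    have := inj k q
    have := mem k
    omega
  have hq3 : 3 ≤ q → n - 1 ≤ q := by
    intro hq3
    obtain ⟨k, hk, hkn, hPk⟩ := surj (n - 1) (by omega) (by omega)
    have hkq : k < q := by
      have h1 : k ≠ q := by rintro rfl; omega
      by_contra hcon
      have := hA 1 k
      have := hA 2 k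
      have := mem 1
      have := mem 2
      have := inj 1 2
      omega
    obtain ⟨i, hi, hin, hTi⟩ := h.right.surj (n - 1) (by omega) (by omega)
    obtain ⟨k', hk', hkn', rfl⟩ := surj i hi hin
    have hk'q : k' < q := by
      by_contra hcon
      rcases hkn'.eq_or_lt with rfl | hlt
      · omega
      · have h1 := hafter k' (by omega) hlt
        have := inj k (k' + 1)
        omega
    have hjk : P n < P k' := by
      rcases hqn.eq_or_lt with rfl | hlt
      · have := inj k' q
        have := mem k'
        omega
      · exact hA k' n hk' hk'q hlt le_rfl
    rcases hin.eq_or_lt with hin | hin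
    · rw [hin] at hTi
      have h1 := h.symm.last (by omega)
      rw [hTi] at h1
      have := inj (n - 1) p
      omega
    · have h1 := hafter' (P k') hjk.le hin
      rw [hTi] at h1
      obtain ⟨k2, hk2, hkn2, hP2⟩ := surj (P k' + 1) (by omega) (by omega)
      have hk2q : k2 < q := by
        have h1 : k2 ≠ q := by rintro rfl; omega
        by_contra hcon
        have := hA k' k2
        omega
      rw [← hP2] at h1
      rcases lt_or_ge k2 p with h2 | h2
      · rw [hbefore k2 hk2 h2] at h1
        have := inj (n - 1) k2
        omega
      · rw [hafter k2 h2 (by omega)] at h1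
        have := inj (n - 1) (k2 + 1)
        omega
  have hcases : q = 2 ∨ 3 ≤ q ∧ q = n - 1 ∨ 3 ≤ q ∧ q = n := by omega
  rcases hcases with rfl | ⟨hq3', hqn'⟩ | ⟨hq3', hqn'⟩
  · obtain rfl : p = 1 := by omega
    exact (h.eq_of_max_first hn hPp av).imp id Or.inr
  · exfalso
    obtain ⟨k, hk, hkn, hPk⟩ := surj 2 (by omega) (by omega)
    have hkn' : k = n := by
      have h1 : k ≠ q := by rintro rfl; omega
      by_contra hcon
      have := hA k n
      have := inj q n
      omega
    rw [hkn'] at hPk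
    have h1 := hafter q hpq.le (by omega)
    rw [hPq, show q + 1 = n by omega, hPk] at h1
    rw [hPk] at hj
    have := h.right.inj 1 3
    grind
  · subst hqn'
    rw [hPq] at hj hTn
    have h3 := hafter' 2 (by omega) (by omega)
    simp only [Nat.reduceAdd] at hj h3
    rw [hj] at h3
    obtain ⟨s, hs, hsn, hPs⟩ := surj 3 (by omega) (by omega)
    have hs1 : s = 1 ∧ 1 < p := by
      rcases lt_or_ge s p with h2 | h2
      · have h4 := hbefore s hs h2
        have := inj 1 s
        grind
      · have h4 : s ≠ q := by rintro rfl; omega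
        have h5 := hafter s h2 (by omega)
        have := inj 1 (s + 1)
        grind
    obtain ⟨rfl, hp1⟩ := hs1
    have hq4 : q ≠ 3 := by
      rintro rfl
      have := inj 1 p
      omega
    have h4 := hafter' 3 (by omega) (by omega)
    rw [← h3, hPs] at h4
    simp only [Nat.reduceAdd] at h4
    obtain ⟨v, hv, hvn, hPv⟩ := surj 4 (by omega) (by omega)
    have hvq : v ≠ q := by rintro rfl; omega
    have hv1 : v ≠ 1 := by rintro rfl; omega
    have hv2 : p = 2 ∧ v = 2 := by
      rcases lt_or_ge v p with h2 | h2
      · have h5 := hbefore v hv h2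
        have := inj 3 v
        have := hinc 1 2
        have := hinc 2 3
        grind
      · have h5 := hafter v h2 (by omega)
        have := inj 3 (v + 1)
        grind
    obtain ⟨rfl, rfl⟩ := hv2
    obtain rfl : q = 4 := by omega
    have := mem 3
    have := inj 3 1
    have := inj 3 2
    have := inj 3 4
    omega

theorem Swapped.max_first_contains_123 {n : ℕ} {P T : ℕ → ℕ} (h : Swapped n P T) (hn : 5 ≤ n)
    (av : ∀ a b c, 1 ≤ a → a < b → b < c → c ≤ n → ¬ (P a < P b ∧ P b < P c)) : P 1 ≠ n := by
  intro hp
  have h2 := h.apply_two (by omega) hp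
  have inj := h.left.inj
  have mem := h.left.mem
  have hdec : ∀ k l, 3 ≤ k → k < l → l ≤ n → P l < P k := by
    intro k l hk hkl hl
    have := av 2 k l
    have := inj 2 k
    have := inj k l
    have := mem k
    omega
  obtain ⟨k, hk, hkn, hPk⟩ := h.left.surj 2 (by omega) (by omega)
  have hkn' : k = n := by
    have h1 : k ≠ 1 := by rintro rfl; omega
    have h2 : k ≠ 2 := by rintro rfl; omega
    have := hdec k n
    have := inj 2 n
    have := mem n
    omega
  rw [hkn'] at hPk
  have hT1 := h.after le_rfl hp 2 (by omega) (by omega)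
  rw [h2] at hT1
  have hT2 := h.last (by omega)
  rw [hPk] at hT2
  obtain ⟨m, hm, hm1, -, hm2⟩ := h.step' 1 le_rfl (by omega)
  obtain rfl : m = 1 := by omega
  simp only [Nat.reduceAdd] at hT1 hm2
  rw [hT1, hT2] at hm2
  have := mem 3
  have := mem 4
  have := hdec 3 4
  have := inj (P 3) 3
  have := inj 1 3
  have := inj 2 4
  have := inj 4 n
  omega

theorem Swapped.max_last_contains_123 {n : ℕ} {P T : ℕ → ℕ} (h : Swapped n P T) (hn : 5 ≤ n)
    (av : ∀ a b c, 1 ≤ a → a < b → b < c → c ≤ n → ¬ (P a < P b ∧ P b < P c)) : P n ≠ n := by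
  intro hp
  have inj := h.left.inj
  have mem := h.left.mem
  have hdec : ∀ k l, 1 ≤ k → k < l → l < n → P l < P k := by
    intro k l hk hkl hl
    have := av k l n
    have := inj l n
    have := inj k l
    have := mem l
    omega
  have hstep : ∀ k, 1 ≤ k → k + 1 < n → T (P k) = P (k + 1) := by
    intro k hk hkn
    obtain ⟨m, hm, hmk, hmax, h1⟩ := h.step k hk (by omega)
    have := hmax k hk le_rfl
    have := hdec k (k + 1)
    omega
  have hT1 : T (P (n - 1)) = P 1 := by
    obtain ⟨m, hm, hmk, hmax, h1⟩ := h.step (n - 1) (by omega) (by omega)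
    have := hmax 1 le_rfl (by omega)
    have hm1 : m = 1 := by
      have := hdec 1 m
      omega
    rw [show n - 1 + 1 = n by omega, hp, hm1] at h1
    have := mem 1
    omega
  have e1 : P (n - 1) = 1 := by
    obtain ⟨k, hk, hkn, hPk⟩ := h.left.surj 1 le_rfl (by omega)
    have h1 : k ≠ n := by rintro rfl; omega
    have := hdec k (n - 1)
    have := mem (n - 1)
    rw [← hPk]
    congr 1
    omega
  have e2 : P (n - 2) = 2 := by
    obtain ⟨k, hk, hkn, hPk⟩ := h.left.surj 2 (by omega) (by omega)
    have h1 : k ≠ n := by rintro rfl; omega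
    have h2 : k ≠ n - 1 := by rintro rfl; omega
    have := hdec k (n - 2)
    have := mem (n - 2)
    have := inj (n - 1) (n - 2)
    rw [← hPk]
    congr 1
    omega
  have e3 : P (n - 3) = 3 := by
    obtain ⟨k, hk, hkn, hPk⟩ := h.left.surj 3 (by omega) (by omega)
    have h1 : k ≠ n := by rintro rfl; omega
    have h2 : k ≠ n - 1 := by rintro rfl; omega
    have h3 : k ≠ n - 2 := by rintro rfl; omega
    have := hdec k (n - 3)
    have := mem (n - 3)
    have := inj (n - 1) (n - 3)
    have := inj (n - 2) (n - 3)
    rw [← hPk]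
    congr 1
    omega
  have hT2 := hstep (n - 2) (by omega) (by omega)
  have hT3 := hstep (n - 3) (by omega) (by omega)
  rw [show n - 2 + 1 = n - 1 by omega, e1, e2] at hT2
  rw [show n - 3 + 1 = n - 2 by omega, e2, e3] at hT3
  rw [e1] at hT1
  obtain ⟨m, hm, hm1, hmax, hm2⟩ := h.step' 2 (by omega) (by omega)
  have := hmax 1 le_rfl (by omega)
  simp only [Nat.reduceAdd] at hm2
  rw [hT2, hT3] at hm2
  have := hdec 1 (n - 3)
  have := inj 1 (n - 2)
  omega

section

variable {n p : ℕ} {P T : ℕ → ℕ}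

theorem Swapped.decreasing_before (h : Swapped n P T) (hpn : p ≤ n) (hPp : P p = n)
    (av : ∀ a b c, 1 ≤ a → a < b → b < c → c ≤ n → ¬ (P a < P b ∧ P b < P c))
    (k l : ℕ) (hk : 1 ≤ k) (hkl : k < l) (hlp : l < p) : P l < P k := by
  have := av k l p hk hkl hlp hpn
  have := h.left.inj l p
  have := h.left.inj k l
  have := h.left.mem l
  omega

theorem Swapped.apply_before (h : Swapped n P T) (hpn : p ≤ n) (hPp : P p = n)
    (av : ∀ a b c, 1 ≤ a → a < b → b < c → c ≤ n → ¬ (P a < P b ∧ P b < P c))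
    (k : ℕ) (hk : 1 ≤ k) (hkp : k + 1 < p) : T (P k) = P (k + 1) := by
  obtain ⟨m, hm, hmk, hmax, h1⟩ := h.step k hk (by omega)
  have := hmax k hk le_rfl
  have := h.decreasing_before hpn hPp av k (k + 1)
  omega

theorem Swapped.apply_just_before (h : Swapped n P T) (hp : 2 ≤ p) (hpn : p ≤ n) (hPp : P p = n)
    (av : ∀ a b c, 1 ≤ a → a < b → b < c → c ≤ n → ¬ (P a < P b ∧ P b < P c)) :
    T (P (p - 1)) = P 1 := by
  obtain ⟨m, hm, hmk, hmax, h1⟩ := h.step (p - 1) (by omega) (by omega)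
  have := hmax 1 le_rfl (by omega)
  have hm1 : m = 1 := by
    have := h.decreasing_before hpn hPp av 1 m
    omega
  rw [show p - 1 + 1 = p by omega, hPp, hm1] at h1
  have := h.left.mem 1
  omega

theorem Swapped.slope_before (h : Swapped n P T) (hpn : p ≤ n) (hPp : P p = n)
    (av : ∀ a b c, 1 ≤ a → a < b → b < c → c ≤ n → ¬ (P a < P b ∧ P b < P c))
    (k : ℕ) (hk : 1 ≤ k) : k < p → P k + k ≤ P 1 + 1 := by
  induction k, hk using Nat.le_induction with
  | base => omega
  | succ k hk ih =>
    intro hkp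
    have := h.decreasing_before hpn hPp av k (k + 1)
    omega

theorem Swapped.contains_123_of_one_before_max (h : Swapped n P T) (hn : 5 ≤ n) (hp : 2 ≤ p)
    (hpn : p < n) (hPp : P p = n) (hone : P (p - 1) = 1)
    (av : ∀ a b c, 1 ≤ a → a < b → b < c → c ≤ n → ¬ (P a < P b ∧ P b < P c)) : False := by
  have inj := h.left.inj
  have mem := h.left.mem
  have surj := h.left.surj
  have hafter := h.after (by omega) hPp
  have hTn := h.last (by omega)
  have hjn := h.apply_last_lt (by omega) hPp hpn
  have hj := h.apply_last_succ (by omega) hPp hpn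
  have hj1 := (mem n (by omega) le_rfl).1
  have hafter' := h.symm.after hj1 hTn
  have hD := h.decreasing_before hpn.le hPp av
  have hT1 := h.apply_just_before hp hpn.le hPp av
  rw [hone] at hT1
  have hE : ∀ k l, p < k → k < l → l ≤ n → P l < P k := by
    intro k l hk hkl hl
    have := av (p - 1) k l
    have := inj (p - 1) k
    have := inj k l
    have := mem k
    omega
  have hjne : P n ≠ 1 := by
    have := inj (p - 1) n
    omega
  obtain ⟨m, hm, hm1, -, hm2⟩ := h.step' 1 le_rfl (by omega)
  obtain rfl : m = 1 := by omega
  simp only [Nat.reduceAdd] at hm2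
  rw [hT1] at hm2
  have hP1 := mem 1
  obtain ⟨s, hs, hsn, hPs⟩ := surj 2 (by omega) (by omega)
  have hsp : s ≠ p := by rintro rfl; omega
  rcases lt_or_gt_of_ne hsp with hsp | hsp
  · have hsp1 : s ≠ p - 1 := by rintro rfl; omega
    have hsp2 : s + 1 = p - 1 := by
      have := hD s (s + 1)
      have := hD (s + 1) (p - 1)
      omega
    have hT2 := h.apply_before hpn.le hPp av s hs (by omega)
    rw [hPs, hsp2, hone] at hT2
    have ha : 2 ≤ P 1 := by
      rcases hs.eq_or_lt with rfl | hs1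
      · omega
      · have := hD 1 s
        omega
    have hPa : P 1 = p - 1 := by
      have := inj (P 1) (p - 1)
      omega
    obtain ⟨m, hm, hm1', hmax, hm3⟩ := h.step' 2 (by omega) (by omega)
    have hm1 : m = 1 := by
      have := hmax 1 le_rfl (by omega)
      by_contra hne
      obtain rfl : m = 2 := by omega
      omega
    subst hm1
    simp only [Nat.reduceAdd] at hm3
    rw [hT1, hT2] at hm3
    have hT3 : P 1 ≤ T 3 := by omega
    have hj3 : P n = 3 := by
      obtain ⟨k, hk, hkn, hPk⟩ := surj 3 (by omega) (by omega)
      have h1 : k ≠ s := by rintro rfl; omega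
      have h2 : k ≠ p - 1 := by rintro rfl; omega
      have h3 : k ≠ p := by rintro rfl; omega
      rcases lt_or_gt_of_ne h3 with h3 | h3
      · have h4 := h.apply_before hpn.le hPp av k hk (by omega)
        rw [hPk] at h4
        have := hD k (k + 1)
        have := hD 1 k
        rcases hk.eq_or_lt with rfl | hk1 <;> omega
      · have := hE k n
        have := inj s n
        rcases hkn.eq_or_lt with rfl | hk1 <;> omega
    rw [hj3] at hj hTn
    have hp3 : p = 3 := by
      by_contra hp3
      have := h.slope_before hpn.le hPp av (p - 3)
      have := mem (p - 3)
      have := inj (p - 3) (p - 1)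
      have := inj (p - 3) s
      have := inj (p - 3) n
      omega
    subst hp3
    have h5 := hafter' 4 (by omega) (by omega)
    simp only [Nat.reduceAdd] at hj h5
    rw [hj, hPp, ← hTn] at h5
    have := h.right.inj 3 5
    omega
  · have hj2 : P n = 2 := by
      have := hE s n
      rcases hsn.eq_or_lt with rfl | hs1 <;> omega
    rw [hj2] at hj hTn
    have hPa : P 1 = 1 := by
      have := inj (P 1) 1
      have := inj 1 p
      omega
    obtain rfl : p = 2 := by
      have := inj 1 (p - 1)
      omega
    have h3 := hafter' 3 (by omega) (by omega)
    simp only [Nat.reduceAdd] at hj h3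
    rw [hj, hPp, ← hTn] at h3
    have := h.right.inj 2 4
    omega

theorem Swapped.contains_123_of_one_last (h : Swapped n P T) (hn : 5 ≤ n) (hp : 2 ≤ p)
    (hpn : p < n) (hPp : P p = n) (hone : P n = 1)
    (av : ∀ a b c, 1 ≤ a → a < b → b < c → c ≤ n → ¬ (P a < P b ∧ P b < P c)) : False := by
  have inj := h.left.inj
  have mem := h.left.mem
  have surj := h.left.surj
  have hafter := h.after (by omega) hPp
  have hTn := h.last (by omega)
  have hj := h.apply_last_succ (by omega) hPp hpn
  rw [hone] at hj hTn
  have hafter' := h.symm.after le_rfl hTn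
  have hD := h.decreasing_before hpn.le hPp av
  have hTD := h.apply_before hpn.le hPp av
  have hTl := h.apply_just_before hp hpn.le hPp av
  have hT3 := hafter' 2 (by omega) (by omega)
  have hT4 := hafter' 3 (by omega) (by omega)
  have hT5 := hafter' 4 (by omega) (by omega)
  simp only [Nat.reduceAdd] at hj hT3 hT4 hT5
  rw [hj] at hT3
  rw [← hT3] at hT4
  have hl : P (p - 1) = 3 := by
    have := mem (p - 1)
    have := h.right.inj (P (p - 1)) 3
    omega
  have hP2 : P (n - 1) = 2 := by
    obtain ⟨s, hs, hsn, hPs⟩ := surj 2 (by omega) (by omega)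
    have h1 : s ≠ p - 1 := by rintro rfl; omega
    have h2 : s ≠ n := by rintro rfl; omega
    have h3 : p ≤ s := by
      have := hD s (p - 1)
      omega
    have h4 := hafter s h3 (by omega)
    rw [hPs, hj] at h4
    have := inj n (s + 1)
    rw [← hPs]
    congr 1
    omega
  obtain ⟨k, hk, hkn, hPk⟩ := surj 4 (by omega) (by omega)
  have hkn' : k ≠ n := by rintro rfl; omega
  have hP1 := mem 1
  have hkp : p < k := by
    have h1 : k ≠ p - 1 := by rintro rfl; omega
    have h2 : k ≠ p := by rintro rfl; omega
    by_contra hcon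
    have h3 := hTD k hk (by omega)
    rw [hPk, ← hT4] at h3
    have := inj (P 1) (k + 1)
    have := h.slope_before hpn.le hPp av (p - 1)
    omega
  have hkn2 : k = n - 2 := by
    have h1 : k ≠ n - 1 := by rintro rfl; omega
    by_contra hcon
    have := av (p - 1) k (k + 1)
    have := mem (k + 1)
    have := inj (k + 1) k
    have := inj (k + 1) (p - 1)
    have := inj (k + 1) (n - 1)
    have := inj (k + 1) n
    omega
  have h4 := hafter k hkp.le (by omega)
  rw [hPk, show k + 1 = n - 1 by omega, hP2] at h4
  have ha : P 1 = n - 1 := by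
    have := inj (P 1) (n - 1)
    omega
  rw [h4] at hT5
  have hp2 : p ≠ 2 := by
    rintro rfl
    simp only [Nat.reduceSub] at hl
    omega
  have hp3 : p ≠ 3 := by
    rintro rfl
    have h5 := hTD 1 le_rfl (by omega)
    have h6 := hafter' (n - 1) (by omega) (by omega)
    have h7 := hafter 3 le_rfl (by omega)
    rw [ha] at h5
    rw [hPp] at h7
    simp only [Nat.reduceAdd, Nat.reduceSub] at h5 h7 hl
    rw [h5, hl, hPp, show n - 1 + 1 = n by omega, h7] at h6
    have := inj 3 4
    omega
  obtain ⟨k5, hk5, hkn5, hP5⟩ := surj 5 (by omega) (by omega)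
  have h1 : k5 ≠ n := by rintro rfl; omega
  have h2 : k5 ≠ p - 1 := by rintro rfl; omega
  have h3 : k5 = 1 := by
    rcases lt_or_ge k5 p with h3 | h3
    · have h6 := hTD k5 hk5 (by omega)
      rw [hP5, ← hT5] at h6
      have := inj 2 (k5 + 1)
      omega
    · have h6 := hafter k5 h3 (by omega)
      rw [hP5, ← hT5] at h6
      have := inj 2 (k5 + 1)
      omega
  subst h3
  have := hD 1 2
  have := hD 2 (p - 1)
  have := inj 2 k
  omega

set_option maxHeartbeats 1000000 in
theorem Swapped.contains_123_of_one_after_max {q : ℕ} (h : Swapped n P T) (hn : 5 ≤ n)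
    (hp : 2 ≤ p) (hpq : p < q) (hqn : q < n) (hPp : P p = n) (hPq : P q = 1)
    (av : ∀ a b c, 1 ≤ a → a < b → b < c → c ≤ n → ¬ (P a < P b ∧ P b < P c)) : False := by
  have inj := h.left.inj
  have mem := h.left.mem
  have surj := h.left.surj
  have hpn : p < n := by omega
  have hafter := h.after (by omega) hPp
  have hTn := h.last (by omega)
  have hjn := h.apply_last_lt (by omega) hPp hpn
  have hj := h.apply_last_succ (by omega) hPp hpn
  have hj1 := (mem n (by omega) le_rfl).1
  have hafter' := h.symm.after hj1 hTn
  have hD := h.decreasing_before hpn.le hPp av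
  have hTD := h.apply_before hpn.le hPp av
  have hTl := h.apply_just_before hp hpn.le hPp av
  have hE : ∀ k l, q < k → k < l → l ≤ n → P l < P k := by
    intro k l hk hkl hl
    have := av q k l
    have := inj q k
    have := inj k l
    have := mem k
    omega
  have hT1 := hafter q hpq.le hqn
  rw [hPq] at hT1
  have hjne : P n ≠ 1 := by
    have := inj q n
    omega
  have hg := mem (q + 1) (by omega) (by omega)
  have hg1 : P (q + 1) ≠ 1 := by
    have := inj q (q + 1)
    omega
  have hgn : P (q + 1) ≠ n := by
    have := inj p (q + 1)
    omega
  have hTpos : ∀ k v, 1 ≤ k → k < n → P k = v → T v = P 1 ∧ k = p - 1 ∨ T v = P (k + 1) := by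
    rintro k v hk hkn rfl
    rcases lt_or_ge k p with h1 | h1
    · by_cases h2 : k = p - 1
      · left
        rw [h2]
        exact ⟨hTl, rfl⟩
      · exact Or.inr (hTD k hk (by omega))
    · exact Or.inr (hafter k h1 hkn)
  have hn1 : P (n - 1) = P n + 1 := by
    obtain ⟨k, hk, hkn, hPk⟩ := surj (P n + 1) (by omega) (by omega)
    have hkn' : k ≠ n := by rintro rfl; omega
    have := hTpos k _ hk (by omega) hPk
    have := inj 1 n
    have := inj (k + 1) n
    rw [show n - 1 = k by omega, hPk]
  have hqn1 : q ≠ n - 1 := by rintro rfl; omega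
  obtain ⟨m, hm, hm1, -, hst1⟩ := h.step' 1 le_rfl (by omega)
  obtain rfl : m = 1 := by omega
  simp only [Nat.reduceAdd] at hst1
  rw [hT1] at hst1
  by_cases hj2 : P n = 2
  · rw [hj2] at hj hTn hn1
    have h4 := hafter' 3 (by omega) (by omega)
    simp only [Nat.reduceAdd] at hj hn1 h4
    rw [hj] at h4
    obtain ⟨k, hk, hkn, hPk⟩ := surj 4 (by omega) (by omega)
    have h1 : k ≠ n := by rintro rfl; omega
    have h2 := hTpos k 4 hk (by omega) hPk
    rw [← h4] at h2
    have := inj 2 1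
    have hk1 : k = 1 := by
      have := inj 2 (k + 1)
      omega
    subst hk1
    have h5 : 2 < p := by
      by_contra h5
      obtain rfl : p = 2 := by omega
      have := hTl
      simp only [Nat.reduceSub] at this
      rw [hPk, ← h4] at this
      omega
    have := hD 1 2
    have := mem 2
    have := inj 2 q
    have := inj 2 n
    have := inj 2 (n - 1)
    omega
  have hj3 : 3 ≤ P n := by omega
  have hT3n : P n = 3 → T 3 = n := by
    intro h3
    rw [h3] at hTn
    exact hTn
  have hq1 : q - 1 ≠ p := by
    intro h1
    have h2 := hafter p le_rfl hpn
    rw [hPp, show p + 1 = q by omega, hPq] at h2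
    have h3 := h.symm.last (by omega)
    rw [h2] at h3
    have := inj 1 p
    omega
  have hw := mem (q - 1) (by omega) (by omega)
  have hwn : P (q - 1) ≠ n := by
    have := inj (q - 1) p
    omega
  have hw1 : P (q - 1) ≠ 1 := by
    have := inj (q - 1) q
    omega
  have hwj : P (q - 1) ≠ P n := by
    have := inj (q - 1) n
    omega
  have hTw := hafter (q - 1) (by omega) (by omega)
  rw [show q - 1 + 1 = q by omega, hPq] at hTw
  have hTw1 : P n < P (q - 1) → P 1 = T (P (q - 1) + 1) := by
    intro h1
    have := hafter' (P (q - 1)) h1.le (by omega)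
    rwa [hTw] at this
  obtain ⟨s, hs, hsn, hPs⟩ := surj 2 (by omega) (by omega)
  have hsn' : s ≠ n := by rintro rfl; omega
  have hsp : s ≠ p := by rintro rfl; omega
  have hsq : s < q := by
    have h1 : s ≠ q := by rintro rfl; omega
    have := hE s n
    omega
  obtain ⟨k, hk, hkn, hPk⟩ := surj 3 (by omega) (by omega)
  have hT3 := hTpos k 3 hk
  have hT2 := hTpos s 2 hs (by omega) hPs
  obtain ⟨m2, hm2, hm2', hmax2, hst2⟩ := h.step' 2 (by omega) (by omega)
  have hmax21 := hmax2 1 le_rfl (by omega)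
  have hmax22 := hmax2 2 (by omega) le_rfl
  simp only [Nat.reduceAdd] at hst2
  rcases lt_or_gt_of_ne hsp with hsp | hsp
  · have hsp1 : s = p - 1 := by
      have := hD s (p - 1)
      have := mem (p - 1)
      have := inj (p - 1) q
      omega
    rw [hsp1] at hPs
    rw [hPs] at hTl
    have := av (p - 1) (q - 1) n
    have := inj (p - 1) (q - 1)
    have := h.right.inj (P (q - 1) + 1) 2
    omega
  have hs1 : T 2 = P (s + 1) := by omega
  by_cases hsq1 : s = q - 1
  · rw [show s + 1 = q by omega, hPq] at hs1
    rw [← hsq1, hPs] at hw hTw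
    have hPg : P (P (q + 1)) = 1 := by omega
    have hgq : P (q + 1) = q := by
      have := inj (P (q + 1)) q
      omega
    obtain rfl : m2 = 1 := by
      by_contra hne
      obtain rfl : m2 = 2 := by omega
      omega
    have hPq1 := inj 1 q
    rw [hT1, hs1, hgq] at hst2
    have hP1q : P 1 ≠ P (q + 1) := by
      have := inj 1 (q + 1)
      omega
    have hT3a : T 3 = P 1 := by omega
    have hP1q : P 1 < q := by omega
    by_cases hj3' : P n = 3
    · omega
    have hk1 : k = p - 1 := by
      have hkn' : k ≠ n := by rintro rfl; omega
      have := hT3 (by omega) hPk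
      have := inj 1 (k + 1)
      omega
    rw [hk1] at hPk
    obtain ⟨m3, hm3, hm3', hmax3, hst3⟩ := h.step' 3 (by omega) (by omega)
    have hmax31 := hmax3 1 le_rfl (by omega)
    obtain rfl : m3 = 1 := by
      by_contra hne
      rcases (show m3 = 2 ∨ m3 = 3 by omega) with rfl | rfl <;> omega
    simp only [Nat.reduceAdd] at hst3
    rw [hT3a, hT1] at hst3
    have hPP : P (P 1) ≠ P (q + 1) := by
      have := inj (P 1) (q + 1)
      have := mem 1
      omega
    have hT4 : T 4 = P (P 1) ∧ T 4 < P (q + 1) := by omega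
    by_cases hj4 : P n = 4
    · rw [hj4] at hTn
      omega
    obtain ⟨l, hl, hln, hPl⟩ := surj 4 (by omega) (by omega)
    have hln' : l ≠ n := by rintro rfl; omega
    have hlp : l ≠ p := by rintro rfl; omega
    have hlp1 : l ≠ p - 1 := by rintro rfl; omega
    have hlq : l ≠ q := by rintro rfl; omega
    have hlq1 : l ≠ q - 1 := by rintro rfl; rw [← hsq1] at hPl; omega
    have h4 := hTpos l 4 hl (by omega) hPl
    have := inj (P 1) (l + 1)
    have := mem 1
    have := h.slope_before hpn.le hPp av (p - 1)
    have := av (p - 1) l n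
    have := hE l n
    omega
  · have hw2 : P (q - 1) ≠ 2 := by
      have := inj (q - 1) s
      omega
    have hwj' : P n < P (q - 1) := by
      have := av s (q - 1) n
      omega
    have hgw : P (q + 1) < P (q - 1) := by
      have := av s (q - 1) (q + 1)
      have := inj (q - 1) (q + 1)
      omega
    have hh := mem (s + 1) (by omega) (by omega)
    have hhw : P (q - 1) ≤ P (s + 1) := by
      have := av s (s + 1) (q - 1)
      have := inj s (s + 1)
      have := inj (s + 1) q
      rcases (show s + 1 ≤ q - 1 by omega).eq_or_lt with h1 | h1
      · rw [h1]
      · omega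
    have hhn : P (s + 1) ≠ n := by
      have := inj (s + 1) p
      omega
    have hgq : P (q + 1) = q + 1 := by
      have := inj (P (q + 1)) (q + 1)
      omega
    obtain rfl : m2 = 2 := by
      by_contra hne
      obtain rfl : m2 = 1 := by omega
      omega
    rw [hs1] at hst2
    have hPh : P (P (s + 1)) ≠ P (s + 1) := by
      have := inj (P (s + 1)) (s + 1)
      omega
    have hPh3 : T 3 = P (P (s + 1)) ∧ T 3 < P (s + 1) := by omega
    by_cases hj3' : P n = 3
    · omega
    have hkn' : k ≠ n := by rintro rfl; omega
    have := hT3 (by omega) hPk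
    have := inj (P (s + 1)) 1
    have := inj (P (s + 1)) (k + 1)
    have := hE k n
    omega

theorem Swapped.contains_123 (h : Swapped n P T) (hn : 5 ≤ n)
    (av : ∀ a b c, 1 ≤ a → a < b → b < c → c ≤ n → ¬ (P a < P b ∧ P b < P c)) : False := by
  obtain ⟨p, hp, hpn, hPp⟩ := h.left.surj n (by omega) le_rfl
  obtain ⟨q, hq, hqn, hPq⟩ := h.left.surj 1 le_rfl (by omega)
  have hp1 : p ≠ 1 := by
    rintro rfl
    exact h.max_first_contains_123 hn av hPp
  have hpn' : p ≠ n := by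
    intro h1
    rw [h1] at hPp
    exact h.max_last_contains_123 hn av hPp
  have hpq : p ≠ q := by
    rintro rfl
    omega
  rcases lt_or_gt_of_ne hpq with hpq | hpq
  · rcases hqn.eq_or_lt with rfl | hqn
    · exact h.contains_123_of_one_last hn (by omega) (by omega) hPp hPq av
    · exact h.contains_123_of_one_after_max hn (by omega) hpq hqn hPp hPq av
  · refine h.contains_123_of_one_before_max hn (by omega) (by omega) hPp ?_ av
    have := h.decreasing_before hpn hPp av q (p - 1) hq
    have := h.left.mem (p - 1)
    rw [← hPq]
    congr 1
    omega

end

theorem permOn_natMap {n : ℕ} (π : Equiv.Perm (Fin n)) : PermOn n (natMap π) where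
  mem i hi hin := by
    obtain ⟨i, rfl⟩ := Nat.exists_eq_succ_of_ne_zero (show i ≠ 0 by omega)
    rw [Nat.succ_eq_add_one, natMap_succ π (by omega)]
    omega
  inj i j hi hin hj hjn hij := by
    obtain ⟨i, rfl⟩ := Nat.exists_eq_succ_of_ne_zero (show i ≠ 0 by omega)
    obtain ⟨j, rfl⟩ := Nat.exists_eq_succ_of_ne_zero (show j ≠ 0 by omega)
    rw [Nat.succ_eq_add_one, Nat.succ_eq_add_one, natMap_succ π (by omega),
      natMap_succ π (by omega), Nat.add_right_cancel_iff, Fin.val_inj, π.injective.eq_iff,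
      Fin.mk.injEq] at hij
    rw [hij]
  surj v hv hvn := by
    obtain ⟨k, hk⟩ := π.surjective ⟨v - 1, by omega⟩
    refine ⟨k + 1, by omega, by omega, ?_⟩
    rw [natMap_succ π k.2, Fin.eta, hk]
    exact Nat.sub_add_cancel hv

theorem swapped_natMap {n : ℕ} {π : Equiv.Perm (Fin n)} (h : theta (theta π) = π) :
    Swapped n (natMap π) (natMap (theta π)) :=
  ⟨permOn_natMap _, permOn_natMap _, theta_eq_iff.1 h, theta_eq_iff.1 rfl⟩

theorem natMap_ext {n : ℕ} {π τ : Equiv.Perm (Fin n)}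
    (h : ∀ i, 1 ≤ i → i ≤ n → natMap π i = natMap τ i) : π = τ := by
  ext i
  have := h (i + 1) (by omega) (by omega)
  rw [natMap_succ π i.2, natMap_succ τ i.2] at this
  simpa using this

theorem PermOn.of_injOn {n : ℕ} {P : ℕ → ℕ} (mem : ∀ i, 1 ≤ i → i ≤ n → 1 ≤ P i ∧ P i ≤ n)
    (inj : ∀ i j, 1 ≤ i → i ≤ n → 1 ≤ j → j ≤ n → P i = P j → i = j) : PermOn n P := by
  refine ⟨mem, inj, fun v hv hvn => ?_⟩
  have hs := Finset.surj_on_of_inj_on_of_card_le (s := Finset.Icc 1 n) (t := Finset.Icc 1 n)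
    (fun i _ => P i) (fun i hi => by
      rw [Finset.mem_Icc] at hi ⊢
      exact mem i hi.1 hi.2)
    (fun i j hi hj hij => by
      rw [Finset.mem_Icc] at hi hj
      exact inj i j hi.1 hi.2 hj.1 hj.2 hij) le_rfl v (Finset.mem_Icc.2 ⟨hv, hvn⟩)
  obtain ⟨k, hk, hkv⟩ := hs
  rw [Finset.mem_Icc] at hk
  exact ⟨k, hk.1, hk.2, hkv.symm⟩

theorem PermOn.exists_natMap {n : ℕ} {P : ℕ → ℕ} (h : PermOn n P) :
    ∃ π : Equiv.Perm (Fin n), ∀ i, 1 ≤ i → i ≤ n → natMap π i = P i := by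
  let f : Fin n → Fin n := fun i => ⟨P (i + 1) - 1, by
    have := h.mem (i + 1)
    omega⟩
  have hf : Function.Injective f := by
    intro i j hij
    have h1 := Fin.val_eq_of_eq hij
    have := h.mem (i + 1)
    have := h.mem (j + 1)
    have := h.inj (i + 1) (j + 1)
    simp only [f] at h1
    ext
    omega
  refine ⟨Equiv.ofBijective f (Finite.injective_iff_bijective.1 hf), fun i hi hin => ?_⟩
  obtain ⟨i, rfl⟩ := Nat.exists_eq_succ_of_ne_zero (show i ≠ 0 by omega)
  rw [Nat.succ_eq_add_one, natMap_succ _ (by omega)]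
  have := h.mem (i + 1)
  simp only [Equiv.ofBijective_apply, f]
  omega

theorem Step.congr {n : ℕ} {P P' T T' : ℕ → ℕ} (h : Step n P T)
    (mem : ∀ i, 1 ≤ i → i ≤ n → 1 ≤ P i ∧ P i ≤ n)
    (hP : ∀ i, 1 ≤ i → i ≤ n → P' i = P i) (hT : ∀ i, 1 ≤ i → i ≤ n → T' i = T i) :
    Step n P' T' := by
  intro i hi hin
  obtain ⟨m, hm, hmi, hmax, h1⟩ := h i hi hin
  have hTi := hT (P i) (mem i hi hin).1 (mem i hi hin).2
  have hPi := hP (i + 1) (by omega)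
  refine ⟨m, hm, hmi, fun k hk hki => ?_, ?_⟩
  · rw [hP k hk (by omega), hP m hm (by omega)]
    exact hmax k hk hki
  · rw [hP i hi hin, hP m hm (by omega), hTi]
    omega

theorem Swapped.exists_natMap {n : ℕ} {P T : ℕ → ℕ} (h : Swapped n P T) :
    ∃ π : Equiv.Perm (Fin n), theta (theta π) = π ∧ ∀ i, 1 ≤ i → i ≤ n → natMap π i = P i := by
  obtain ⟨π, hπ⟩ := h.left.exists_natMap
  obtain ⟨τ, hτ⟩ := h.right.exists_natMap
  refine ⟨π, ?_, hπ⟩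
  rw [theta_eq_iff.2 (h.step'.congr h.right.mem hτ hπ)]
  exact theta_eq_iff.2 (h.step.congr h.left.mem hπ hτ)

/-- No three letters of `P 1, …, P n`, taken in order of position, satisfy `R`. -/
def AvoidsRel (n : ℕ) (R : ℕ → ℕ → ℕ → Prop) (P : ℕ → ℕ) : Prop :=
  ∀ a b c, 1 ≤ a → a < b → b < c → c ≤ n → ¬ R (P a) (P b) (P c)

theorem contains_iff {n : ℕ} {π : Equiv.Perm (Fin n)} {σ : Equiv.Perm (Fin 3)} :
    Contains σ π ↔ ∃ a b c, 1 ≤ a ∧ a < b ∧ b < c ∧ c ≤ n ∧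
      (natMap π a < natMap π b ↔ σ 0 < σ 1) ∧ (natMap π a < natMap π c ↔ σ 0 < σ 2) ∧
      (natMap π b < natMap π c ↔ σ 1 < σ 2) := by
  constructor
  · rintro ⟨f, hf, h⟩
    have h01 := hf (show (0 : Fin 3) < 1 by decide)
    have h12 := hf (show (1 : Fin 3) < 2 by decide)
    refine ⟨f 0 + 1, f 1 + 1, f 2 + 1, by omega, by omega, by omega, by omega, ?_⟩
    simp only [natMap_succ π (f _).2, ← h, Fin.eta, Nat.add_lt_add_iff_right, Fin.val_fin_lt,
      and_self]
  · rintro ⟨a, b, c, ha, hab, hbc, hcn, h01, h02, h12⟩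
    obtain ⟨a, rfl⟩ := Nat.exists_eq_succ_of_ne_zero (show a ≠ 0 by omega)
    obtain ⟨b, rfl⟩ := Nat.exists_eq_succ_of_ne_zero (show b ≠ 0 by omega)
    obtain ⟨c, rfl⟩ := Nat.exists_eq_succ_of_ne_zero (show c ≠ 0 by omega)
    simp only [Nat.succ_eq_add_one] at hab hbc hcn h01 h02 h12
    rw [natMap_succ π (by omega), natMap_succ π (by omega), Nat.add_lt_add_iff_right,
      Fin.val_fin_lt] at h01 h02 h12
    have key : ∀ (x y : Fin n) (u v : Fin 3), x ≠ y → u ≠ v → (π x < π y ↔ σ u < σ v) →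
        (π y < π x ↔ σ v < σ u) := by
      intro x y u v hxy huv h1
      have h2 := Fin.val_ne_of_ne (π.injective.ne hxy)
      have h3 := Fin.val_ne_of_ne (σ.injective.ne huv)
      simp only [Fin.lt_def] at h1 ⊢
      omega
    have e01 := key ⟨a, by omega⟩ ⟨b, by omega⟩ 0 1 (by simp; omega) (by decide) h01
    have e02 := key ⟨a, by omega⟩ ⟨c, by omega⟩ 0 2 (by simp; omega) (by decide) h02
    have e12 := key ⟨b, by omega⟩ ⟨c, by omega⟩ 1 2 (by simp; omega) (by decide) h12
    refine ⟨![⟨a, by omega⟩, ⟨b, by omega⟩, ⟨c, by omega⟩], ?_, ?_⟩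
    · rw [Fin.strictMono_iff_lt_succ]
      intro i
      fin_cases i
      · show a < b
        omega
      · show b < c
        omega
    · intro x y
      fin_cases x <;> fin_cases y <;>
        first | assumption | exact iff_of_false (lt_irrefl _) (lt_irrefl _)

theorem avoids_p123 {n : ℕ} {π : Equiv.Perm (Fin n)} :
    Avoids π p123 ↔ AvoidsRel n (fun x y z => x < y ∧ y < z) (natMap π) := by
  have h01 : p123 0 < p123 1 := by simp [p123]
  have h02 : p123 0 < p123 2 := by simp [p123]
  have h12 : p123 1 < p123 2 := by simp [p123]
  simp only [Avoids, contains_iff, AvoidsRel, h01, h02, h12, iff_true]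
  constructor
  · intro h a b c ha hab hbc hcn hR
    exact h ⟨a, b, c, ha, hab, hbc, hcn, by omega⟩
  · rintro h ⟨a, b, c, ha, hab, hbc, hcn, hR⟩
    have inj := (permOn_natMap π).inj
    have := inj a b
    have := inj b c
    exact h a b c ha hab hbc hcn (by omega)

theorem avoids_p132 {n : ℕ} {π : Equiv.Perm (Fin n)} :
    Avoids π p132 ↔ AvoidsRel n (fun x y z => x < z ∧ z < y) (natMap π) := by
  have h01 : p132 0 < p132 1 := by simp [p132]
  have h02 : p132 0 < p132 2 := by simp [p132]
  have h12 : ¬ p132 1 < p132 2 := by simp [p132]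
  simp only [Avoids, contains_iff, AvoidsRel, h01, h02, h12, iff_true, iff_false]
  constructor
  · intro h a b c ha hab hbc hcn hR
    exact h ⟨a, b, c, ha, hab, hbc, hcn, by omega⟩
  · rintro h ⟨a, b, c, ha, hab, hbc, hcn, hR⟩
    have inj := (permOn_natMap π).inj
    have := inj a b
    have := inj b c
    exact h a b c ha hab hbc hcn (by omega)

theorem avoids_p213 {n : ℕ} {π : Equiv.Perm (Fin n)} :
    Avoids π p213 ↔ AvoidsRel n (fun x y z => y < x ∧ x < z) (natMap π) := by
  have h01 : ¬ p213 0 < p213 1 := by simp [p213]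
  have h02 : p213 0 < p213 2 := by simp [p213]
  have h12 : p213 1 < p213 2 := by simp [p213]
  simp only [Avoids, contains_iff, AvoidsRel, h01, h02, h12, iff_true, iff_false]
  constructor
  · intro h a b c ha hab hbc hcn hR
    exact h ⟨a, b, c, ha, hab, hbc, hcn, by omega⟩
  · rintro h ⟨a, b, c, ha, hab, hbc, hcn, hR⟩
    have inj := (permOn_natMap π).inj
    have := inj a b
    have := inj b c
    exact h a b c ha hab hbc hcn (by omega)

/-- The word `a b c d`. -/
def word (a b c d : ℕ) (i : ℕ) : ℕ :=
  if i = 1 then a else if i = 2 then b else if i = 3 then c else d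

/-- The map acting as `f` on the four points `d + 1, …, d + 4`, and fixing all others. -/
def blockMap (d : ℕ) (f : ℕ → ℕ) (i : ℕ) : ℕ :=
  if d < i ∧ i ≤ d + 4 then d + f (i - d) else i

theorem PermOn.block {f : ℕ → ℕ} (h : PermOn 4 f) {n d : ℕ} (hd : d + 4 ≤ n) :
    PermOn n (blockMap d f) := by
  refine PermOn.of_injOn (fun i hi hin => ?_) fun i j hi hin hj hjn hij => ?_
  · have := h.mem (i - d)
    unfold blockMap
    split_ifs <;> omega
  · have := h.mem (i - d)
    have := h.mem (j - d)
    have := h.inj (i - d) (j - d)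
    unfold blockMap at hij
    split_ifs at hij <;> omega

theorem Step.block {f t : ℕ → ℕ} (hs : Step 4 f t) (h : PermOn 4 f) {n d : ℕ} (hd : d + 4 ≤ n) :
    Step n (blockMap d f) (blockMap d t) := by
  have mem := (h.block hd).mem
  have out : ∀ g i, i ≤ d ∨ d + 4 < i → blockMap d g i = i := fun g i hi => if_neg (by omega)
  have ins : ∀ g i, 1 ≤ i → i ≤ 4 → blockMap d g (d + i) = d + g i := by
    intro g i h1 h2
    rw [blockMap, if_pos (by omega), Nat.add_sub_cancel_left]
  intro i hi hin
  by_cases hid : d < i ∧ i ≤ d + 4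
  · obtain ⟨i, rfl⟩ := Nat.exists_eq_add_of_lt hid.1
    rw [add_assoc] at hid ⊢
    obtain ⟨m, hm, hmi, hmax, h1⟩ := hs (i + 1) (by omega) (by omega)
    have := h.mem (i + 1) (by omega) (by omega)
    have := h.mem m hm (by omega)
    refine ⟨d + m, by omega, by omega, fun k hk hki => ?_, ?_⟩
    · rw [ins f m hm (by omega)]
      by_cases hkd : k ≤ d
      · rw [out f k (Or.inl hkd)]
        omega
      · have := ins f (k - d) (by omega) (by omega)
        have := hmax (k - d) (by omega) (by omega)
        rw [show d + (k - d) = k by omega] at *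
        omega
    · rw [ins f m hm (by omega), ins f (i + 1) (by omega) (by omega),
        ins t (f (i + 1)) (by omega) (by omega)]
      rcases (show i + 1 ≤ 4 by omega).eq_or_lt with h4 | h4
      · have := out f (d + (i + 1) + 1) (by omega)
        omega
      · have := ins f (i + 1 + 1) (by omega) (by omega)
        rw [add_assoc d]
        omega
  · refine ⟨i, hi, le_rfl, fun k hk hki => ?_, Or.inr ⟨fun hlt => ?_, ?_⟩⟩
    · rw [out f i (by omega)]
      have := h.mem (k - d)
      unfold blockMap
      split_ifs <;> omega
    · rw [out f i (by omega)]
      have := h.mem (i + 1 - d)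
      unfold blockMap
      split_ifs <;> omega
    · rw [out f i (by omega), out t i (by omega)]

theorem Swapped.block {f t : ℕ → ℕ} (h : Swapped 4 f t) {n d : ℕ} (hd : d + 4 ≤ n) :
    Swapped n (blockMap d f) (blockMap d t) :=
  ⟨h.left.block hd, h.right.block hd, h.step.block h.left hd, h.step'.block h.right hd⟩

theorem permOn_word {a b c d : ℕ} (ha : 1 ≤ a ∧ a ≤ 4) (hb : 1 ≤ b ∧ b ≤ 4) (hc : 1 ≤ c ∧ c ≤ 4)
    (hd : 1 ≤ d ∧ d ≤ 4) (hne : a ≠ b ∧ a ≠ c ∧ a ≠ d ∧ b ≠ c ∧ b ≠ d ∧ c ≠ d) :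
    PermOn 4 (word a b c d) := by
  refine PermOn.of_injOn (fun i hi hin => ?_) fun i j hi hin hj hjn hij => ?_
  · unfold word
    split_ifs <;> omega
  · unfold word at hij
    split_ifs at hij <;> omega

theorem step_four {P T : ℕ → ℕ} (h1 : P 2 < P 1 ∧ T (P 1) = P 2 ∨ P 1 < P 2 ∧ T (P 1) = P 1)
    (h2 : ∃ m, 1 ≤ m ∧ m ≤ 2 ∧ (P 1 ≤ P m ∧ P 2 ≤ P m) ∧
      (P 3 < P m ∧ T (P 2) = P 3 ∨ P m < P 3 ∧ T (P 2) = P m))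
    (h3 : ∃ m, 1 ≤ m ∧ m ≤ 3 ∧ (P 1 ≤ P m ∧ P 2 ≤ P m ∧ P 3 ≤ P m) ∧
      (P 4 < P m ∧ T (P 3) = P 4 ∨ P m < P 4 ∧ T (P 3) = P m))
    (h4 : ∃ m, 1 ≤ m ∧ m ≤ 4 ∧ (P 1 ≤ P m ∧ P 2 ≤ P m ∧ P 3 ≤ P m ∧ P 4 ≤ P m) ∧
      T (P 4) = P m) : Step 4 P T := by
  intro i hi hin
  obtain ⟨m2, hm2⟩ := h2
  obtain ⟨m3, hm3⟩ := h3
  obtain ⟨m4, hm4⟩ := h4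
  interval_cases i
  · refine ⟨1, le_rfl, le_rfl, fun k hk hki => ?_, by simp only [Nat.reduceAdd]; omega⟩
    interval_cases k
    exact le_rfl
  · refine ⟨m2, by omega, by omega, fun k hk hki => ?_, by simp only [Nat.reduceAdd]; omega⟩
    interval_cases k <;> omega
  · refine ⟨m3, by omega, by omega, fun k hk hki => ?_, by simp only [Nat.reduceAdd]; omega⟩
    interval_cases k <;> omega
  · refine ⟨m4, by omega, by omega, fun k hk hki => ?_, by simp only [Nat.reduceAdd]; omega⟩
    interval_cases k <;> omega

theorem swapped_1234 : Swapped 4 (word 1 2 3 4) (word 1 2 3 4) := by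
  have h := permOn_word (a := 1) (b := 2) (c := 3) (d := 4) (by decide) (by decide) (by decide)
    (by decide) (by decide)
  have hs : Step 4 (word 1 2 3 4) (word 1 2 3 4) :=
    step_four (by decide) ⟨2, by decide⟩ ⟨3, by decide⟩ ⟨4, by decide⟩
  exact ⟨h, h, hs, hs⟩

theorem swapped_2134 : Swapped 4 (word 2 1 3 4) (word 2 1 3 4) := by
  have h := permOn_word (a := 2) (b := 1) (c := 3) (d := 4) (by decide) (by decide) (by decide)
    (by decide) (by decide)
  have hs : Step 4 (word 2 1 3 4) (word 2 1 3 4) :=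
    step_four (by decide) ⟨1, by decide⟩ ⟨3, by decide⟩ ⟨4, by decide⟩
  exact ⟨h, h, hs, hs⟩

theorem swapped_1243 : Swapped 4 (word 1 2 4 3) (word 1 2 4 3) := by
  have h := permOn_word (a := 1) (b := 2) (c := 4) (d := 3) (by decide) (by decide) (by decide)
    (by decide) (by decide)
  have hs : Step 4 (word 1 2 4 3) (word 1 2 4 3) :=
    step_four (by decide) ⟨2, by decide⟩ ⟨3, by decide⟩ ⟨3, by decide⟩
  exact ⟨h, h, hs, hs⟩

theorem swapped_3421 : Swapped 4 (word 3 4 2 1) (word 4 1 3 2) := by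
  refine ⟨permOn_word ?_ ?_ ?_ ?_ ?_, permOn_word ?_ ?_ ?_ ?_ ?_,
    step_four ?_ ⟨2, ?_⟩ ⟨2, ?_⟩ ⟨2, ?_⟩, step_four ?_ ⟨1, ?_⟩ ⟨1, ?_⟩ ⟨1, ?_⟩⟩ <;> decide

/-- The words in positions `d + 1, …, d + 4` of the `213`-avoiding solutions. -/
def words213 : Fin 4 → ℕ → ℕ := ![word 1 2 3 4, word 1 2 4 3, word 3 4 2 1, word 4 1 3 2]

/-- The words in positions `1, …, 4` of the `132`-avoiding solutions. -/
def words132 : Fin 3 → ℕ → ℕ := ![word 1 2 3 4, word 2 1 3 4, word 3 4 2 1]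

theorem exists_swapped_words213 (a : Fin 4) : ∃ t, Swapped 4 (words213 a) t := by
  fin_cases a
  exacts [⟨_, swapped_1234⟩, ⟨_, swapped_1243⟩, ⟨_, swapped_3421⟩, ⟨_, swapped_3421.symm⟩]

theorem exists_swapped_words132 (a : Fin 3) : ∃ t, Swapped 4 (words132 a) t := by
  fin_cases a
  exacts [⟨_, swapped_1234⟩, ⟨_, swapped_2134⟩, ⟨_, swapped_3421⟩]

theorem words213_injective {a b : Fin 4}
    (h : ∀ i, 1 ≤ i → i ≤ 4 → words213 a i = words213 b i) : a = b := by
  have h1 := h 1 (by decide) (by decide)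
  have h3 := h 3 (by decide) (by decide)
  revert h1 h3
  clear h
  revert a b
  decide

theorem words132_injective {a b : Fin 3}
    (h : ∀ i, 1 ≤ i → i ≤ 4 → words132 a i = words132 b i) : a = b := by
  have h1 := h 1 (by decide) (by decide)
  revert h1
  clear h
  revert a b
  decide

theorem blockMap_injective {d : ℕ} {f g : ℕ → ℕ} {n : ℕ} (hd : d + 4 ≤ n)
    (h : ∀ i, 1 ≤ i → i ≤ n → blockMap d f i = blockMap d g i) (i : ℕ) (hi : 1 ≤ i) (hi4 : i ≤ 4) :
    f i = g i := by
  have := h (d + i) (by omega) (by omega)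
  simp only [blockMap, Nat.add_sub_cancel_left] at this
  rw [if_pos (by omega), if_pos (by omega)] at this
  omega

theorem avoidsRel_blockMap_213 {f : ℕ → ℕ} (h : PermOn 4 f) {d : ℕ}
    (hf : AvoidsRel 4 (fun x y z => y < x ∧ x < z) f) :
    AvoidsRel (d + 4) (fun x y z => y < x ∧ x < z) (blockMap d f) := by
  intro a b c ha hab hbc hcn
  have := h.mem (a - d)
  have := h.mem (b - d)
  have := h.mem (c - d)
  have := hf (a - d) (b - d) (c - d)
  simp only [blockMap]
  split_ifs <;> omega

theorem avoidsRel_blockMap_132 {f : ℕ → ℕ} (h : PermOn 4 f) {n : ℕ}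
    (hf : AvoidsRel 4 (fun x y z => x < z ∧ z < y) f) :
    AvoidsRel n (fun x y z => x < z ∧ z < y) (blockMap 0 f) := by
  intro a b c ha hab hbc hcn
  have := h.mem a
  have := h.mem b
  have := h.mem c
  have := hf a b c
  simp only [blockMap, Nat.sub_zero, Nat.zero_add]
  split_ifs <;> omega

theorem avoidsRel_words213 (a : Fin 4) :
    AvoidsRel 4 (fun x y z => y < x ∧ x < z) (words213 a) := by
  intro i j k hi hij hjk hk
  have hi' : i ≤ 2 := by omega
  have hj' : j ≤ 3 := by omega
  fin_cases a <;> interval_cases i <;> interval_cases j <;> interval_cases k <;> decide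

theorem avoidsRel_words132 (a : Fin 3) :
    AvoidsRel 4 (fun x y z => x < z ∧ z < y) (words132 a) := by
  intro i j k hi hij hjk hk
  have hi' : i ≤ 2 := by omega
  have hj' : j ≤ 3 := by omega
  fin_cases a <;> interval_cases i <;> interval_cases j <;> interval_cases k <;> decide

theorem AvoidsRel.congr {n : ℕ} {R : ℕ → ℕ → ℕ → Prop} {P P' : ℕ → ℕ} (h : AvoidsRel n R P)
    (hP : ∀ i, 1 ≤ i → i ≤ n → P' i = P i) : AvoidsRel n R P' := by
  intro a b c ha hab hbc hcn
  rw [hP a (by omega) (by omega), hP b (by omega) (by omega), hP c (by omega) hcn]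
  exact h a b c ha hab hbc hcn

theorem card_eq_of_classification {n k : ℕ} {σ : Equiv.Perm (Fin 3)} {R : ℕ → ℕ → ℕ → Prop}
    (hσ : ∀ π : Equiv.Perm (Fin n), Avoids π σ ↔ AvoidsRel n R (natMap π))
    {F : Fin k → ℕ → ℕ} (hF : ∀ a, ∃ t, Swapped n (F a) t) (hR : ∀ a, AvoidsRel n R (F a))
    (inj : ∀ a b, (∀ i, 1 ≤ i → i ≤ n → F a i = F b i) → a = b)
    (surj : ∀ P T, Swapped n P T → AvoidsRel n R P → ∃ a, ∀ i, 1 ≤ i → i ≤ n → P i = F a i) :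
    Nat.card {π : Equiv.Perm (Fin n) // theta (theta π) = π ∧ Avoids π σ} = k := by
  have hG : ∀ a, ∃ π : Equiv.Perm (Fin n), theta (theta π) = π ∧
      ∀ i, 1 ≤ i → i ≤ n → natMap π i = F a i := fun a => (hF a).choose_spec.exists_natMap
  choose G hG hGF using hG
  have hbij : Function.Bijective (fun a => (⟨G a, hG a, (hσ _).2 ((hR a).congr (hGF a))⟩ :
      {π : Equiv.Perm (Fin n) // theta (theta π) = π ∧ Avoids π σ})) := by
    constructor
    · intro a b hab
      rw [Subtype.mk.injEq] at hab
      refine inj a b fun i hi hin => ?_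
      rw [← hGF a i hi hin, ← hGF b i hi hin, hab]
    · rintro ⟨π, hπ, hav⟩
      obtain ⟨a, ha⟩ := surj _ _ (swapped_natMap hπ) ((hσ π).1 hav)
      refine ⟨a, Subtype.ext (natMap_ext fun i hi hin => ?_)⟩
      rw [hGF a i hi hin, ha i hi hin]
  rw [← Nat.card_eq_of_bijective _ hbij, Nat.card_fin]

theorem Swapped.restrict {n : ℕ} {P T : ℕ → ℕ} (h : Swapped (n + 1) P T)
    (hP : P (n + 1) = n + 1) : Swapped n P T := by
  have aux : ∀ {P T : ℕ → ℕ}, Swapped (n + 1) P T → P (n + 1) = n + 1 →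
      PermOn n P ∧ Step n P T := by
    intro P T h hP
    have mem := h.left.mem
    have inj := h.left.inj
    refine ⟨PermOn.of_injOn (fun i hi hin => ?_) fun i j hi hin hj hjn hij => ?_,
      fun i hi hin => ?_⟩
    · have := mem i
      have := inj i (n + 1)
      omega
    · exact inj i j hi (by omega) hj (by omega) hij
    · obtain ⟨m, hm, hmi, hmax, h1⟩ := h.step i hi (by omega)
      refine ⟨m, hm, hmi, hmax, ?_⟩
      have := mem m
      rcases hin.eq_or_lt with rfl | hin <;> omega
  have hT : T (n + 1) = n + 1 := by
    have := h.last (by omega)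
    rwa [hP] at this
  exact ⟨(aux h hP).1, (aux h.symm hT).1, (aux h hP).2, (aux h.symm hT).2⟩

theorem Swapped.shift {n : ℕ} {P T : ℕ → ℕ} (h : Swapped (n + 1) P T) (hP : P 1 = 1) :
    Swapped n (fun i => P (i + 1) - 1) (fun i => T (i + 1) - 1) := by
  have aux : ∀ {P T : ℕ → ℕ}, Swapped (n + 1) P T → P 1 = 1 →
      PermOn n (fun i => P (i + 1) - 1) ∧
      Step n (fun i => P (i + 1) - 1) (fun i => T (i + 1) - 1) := by
    intro P T h hP
    have mem := h.left.mem
    have inj := h.left.inj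
    have two : ∀ i, 1 ≤ i → i ≤ n → 2 ≤ P (i + 1) := by
      intro i hi hin
      have := mem (i + 1)
      have := inj 1 (i + 1)
      omega
    refine ⟨PermOn.of_injOn (fun i hi hin => ?_) fun i j hi hin hj hjn hij => ?_,
      fun i hi hin => ?_⟩
    · have := mem (i + 1)
      have := two i
      omega
    · have := two i
      have := two j
      have := inj (i + 1) (j + 1)
      omega
    · obtain ⟨m, hm, hmi, hmax, h1⟩ := h.step (i + 1) (by omega) (by omega)
      have h2 := two i hi hin
      have h3 := hmax (i + 1) (by omega) le_rfl
      have hm1 : m ≠ 1 := by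
        rintro rfl
        omega
      refine ⟨m - 1, by omega, by omega, fun k hk hki => ?_, ?_⟩
      · have := hmax (k + 1) (by omega) (by omega)
        dsimp only
        rw [Nat.sub_add_cancel hm]
        omega
      · have := two (i + 1) (by omega)
        dsimp only
        rw [Nat.sub_add_cancel hm, Nat.sub_add_cancel (by omega : 1 ≤ P (i + 1))]
        omega
  have hT : T 1 = 1 := by
    obtain ⟨m, hm, hmi, hmax, h1⟩ := h.step 1 le_rfl (by omega)
    obtain rfl : m = 1 := by omega
    have := h.left.mem 2
    simp only [Nat.reduceAdd, hP] at h1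
    omega
  exact ⟨(aux h hP).1, (aux h.symm hT).1, (aux h hP).2, (aux h.symm hT).2⟩

theorem Swapped.eq_blockMap_of_avoids_132 {n : ℕ} (hn : 4 ≤ n) {P T : ℕ → ℕ} (h : Swapped n P T)
    (av : AvoidsRel n (fun x y z => x < z ∧ z < y) P) :
    ∃ a, ∀ i, 1 ≤ i → i ≤ n → P i = blockMap 0 (words132 a) i := by
  induction n, hn using Nat.le_induction with
  | base =>
    have key : P 1 = 1 ∧ P 2 = 2 ∧ P 3 = 3 ∧ P 4 = 4 ∨ P 1 = 2 ∧ P 2 = 1 ∧ P 3 = 3 ∧ P 4 = 4 ∨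
        P 1 = 3 ∧ P 2 = 4 ∧ P 3 = 2 ∧ P 4 = 1 := by
      rcases h.fix_last (by omega) av with h4 | ⟨-, h4⟩
      · have h' := h.restrict h4
        have := h'.fix_last le_rfl fun a b c ha hab hbc hcn => av a b c ha hab hbc (by omega)
        have := h'.left.mem 1
        have := h'.left.mem 2
        have := h'.left.inj 1 2
        have := h'.left.inj 1 3
        have := h'.left.inj 2 3
        omega
      · omega
    rcases key with ⟨h1, h2, h3, h4⟩ | ⟨h1, h2, h3, h4⟩ | ⟨h1, h2, h3, h4⟩
    · refine ⟨0, fun i hi hin => ?_⟩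
      interval_cases i <;> first | exact h1 | exact h2 | exact h3 | exact h4
    · refine ⟨1, fun i hi hin => ?_⟩
      interval_cases i <;> first | exact h1 | exact h2 | exact h3 | exact h4
    · refine ⟨2, fun i hi hin => ?_⟩
      interval_cases i <;> first | exact h1 | exact h2 | exact h3 | exact h4
  | succ n hn ih =>
    have hl : P (n + 1) = n + 1 := (h.fix_last (by omega) av).resolve_right (by omega)
    obtain ⟨a, ha⟩ := ih (h.restrict hl) fun a b c ha hab hbc hcn => av a b c ha hab hbc (by omega)
    refine ⟨a, fun i hi hin => ?_⟩
    rcases hin.eq_or_lt with rfl | hin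
    · rw [hl, blockMap, if_neg (by omega)]
    · exact ha i hi (by omega)

theorem AvoidsRel.shift_213 {n : ℕ} {P : ℕ → ℕ}
    (av : AvoidsRel (n + 1) (fun x y z => y < x ∧ x < z) P) :
    AvoidsRel n (fun x y z => y < x ∧ x < z) (fun i => P (i + 1) - 1) := by
  intro a b c ha hab hbc hcn
  have := av (a + 1) (b + 1) (c + 1)
  dsimp only
  omega

theorem Swapped.eq_blockMap_of_avoids_213 {d : ℕ} {P T : ℕ → ℕ} (h : Swapped (d + 4) P T)
    (av : AvoidsRel (d + 4) (fun x y z => y < x ∧ x < z) P) :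
    ∃ a, ∀ i, 1 ≤ i → i ≤ d + 4 → P i = blockMap d (words213 a) i := by
  induction d generalizing P T with
  | zero =>
    rw [Nat.zero_add] at h av ⊢
    have key : P 1 = 1 ∧ P 2 = 2 ∧ P 3 = 3 ∧ P 4 = 4 ∨ P 1 = 1 ∧ P 2 = 2 ∧ P 3 = 4 ∧ P 4 = 3 ∨
        P 1 = 3 ∧ P 2 = 4 ∧ P 3 = 2 ∧ P 4 = 1 ∨ P 1 = 4 ∧ P 2 = 1 ∧ P 3 = 3 ∧ P 4 = 2 := by
      rcases h.fix_first (by omega) av with h1 | ⟨-, h1⟩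
      · have := (Swapped.shift (n := 3) h h1).fix_first le_rfl (AvoidsRel.shift_213 (n := 3) av)
        simp only [Nat.reduceAdd] at this
        have h2 := h.left.mem 2 (by decide) (by decide)
        have h3 := h.left.mem 3 (by decide) (by decide)
        have h4 := h.left.mem 4 (by decide) (by decide)
        have := h.left.inj 1 3
        have := h.left.inj 1 4
        have := h.left.inj 2 3
        have := h.left.inj 2 4
        have := h.left.inj 3 4
        have h2 : P 2 = 2 := by
          have := h.left.inj 1 2
          omega
        omega
      · omega
    rcases key with ⟨h1, h2, h3, h4⟩ | ⟨h1, h2, h3, h4⟩ | ⟨h1, h2, h3, h4⟩ | ⟨h1, h2, h3, h4⟩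
    · refine ⟨0, fun i hi hin => ?_⟩
      interval_cases i <;> first | exact h1 | exact h2 | exact h3 | exact h4
    · refine ⟨1, fun i hi hin => ?_⟩
      interval_cases i <;> first | exact h1 | exact h2 | exact h3 | exact h4
    · refine ⟨2, fun i hi hin => ?_⟩
      interval_cases i <;> first | exact h1 | exact h2 | exact h3 | exact h4
    · refine ⟨3, fun i hi hin => ?_⟩
      interval_cases i <;> first | exact h1 | exact h2 | exact h3 | exact h4
  | succ d ih =>
    rw [show d + 1 + 4 = d + 4 + 1 by omega] at h av ⊢
    have h1 : P 1 = 1 := (h.fix_first (by omega) av).resolve_right (by omega)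
    obtain ⟨a, ha⟩ := ih (h.shift h1) av.shift_213
    refine ⟨a, fun i hi hin => ?_⟩
    rcases hi.eq_or_lt with rfl | hi
    · rw [h1, blockMap, if_neg (by omega)]
    · have h2 := ha (i - 1) (by omega) (by omega)
      have := h.left.mem i
      have := h.left.inj 1 i
      simp only [Nat.sub_add_cancel hi.le, blockMap] at h2 ⊢
      rw [show i - 1 - d = i - (d + 1) by omega] at h2
      split_ifs at h2 ⊢ <;> omega

/-- for `n ≥ 5`, the number of permutations with `θ²(π) = π` avoiding
`σ` is `4` for `σ = 213`, `3` for `σ = 132`, and `0` for `σ = 123`. -/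
theorem f2_n_small (n : ℕ) (hn : 5 ≤ n) :
    Nat.card {π : Equiv.Perm (Fin n) // theta (theta π) = π ∧ Avoids π p213} = 4 ∧
    Nat.card {π : Equiv.Perm (Fin n) // theta (theta π) = π ∧ Avoids π p132} = 3 ∧
    Nat.card {π : Equiv.Perm (Fin n) // theta (theta π) = π ∧ Avoids π p123} = 0 := by
  refine ⟨?_, ?_, ?_⟩
  · obtain ⟨d, rfl⟩ := Nat.exists_eq_add_of_le' (show 4 ≤ n by omega)
    refine card_eq_of_classification (F := fun a => blockMap d (words213 a))
      (fun _ => avoids_p213) (fun a => ?_) (fun a => ?_)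
      (fun a b hab => words213_injective (blockMap_injective le_rfl hab))
      fun P T h av => h.eq_blockMap_of_avoids_213 av
    · obtain ⟨t, ht⟩ := exists_swapped_words213 a
      exact ⟨_, ht.block le_rfl⟩
    · obtain ⟨t, ht⟩ := exists_swapped_words213 a
      exact avoidsRel_blockMap_213 ht.left (avoidsRel_words213 a)
  · refine card_eq_of_classification (F := fun a => blockMap 0 (words132 a))
      (fun _ => avoids_p132) (fun a => ?_) (fun a => ?_)
      (fun a b hab => words132_injective (blockMap_injective (d := 0) (by omega) hab))
      fun P T h av => h.eq_blockMap_of_avoids_132 (by omega) av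
    · obtain ⟨t, ht⟩ := exists_swapped_words132 a
      exact ⟨_, ht.block (by omega)⟩
    · obtain ⟨t, ht⟩ := exists_swapped_words132 a
      exact avoidsRel_blockMap_132 ht.left (avoidsRel_words132 a)
  · rw [Nat.card_eq_zero]
    refine Or.inl ⟨fun ⟨π, hπ, hav⟩ => ?_⟩
    exact (swapped_natMap hπ).contains_123 hn (avoids_p123.1 hav)
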